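/- (Gaussian recursion step.) Let x ∼ N(0, I_n) be a standard Gaussian vector in ℝⁿ, let P(x) = Σ_{i ∈ [n]^d} A_i · x_{i_1} ⋯ x_{i_d} be a degree-d homogeneous Gaussian polynomial random matrix with deterministic coefficient matrices {A_i}_{i ∈ [n]^d}, and let a, b ∈ ℤ_{≥0} with a + b = k < d. Then for every 2 ≤ t < ∞, E ‖P_{a,b} − E P_{a,b}‖_{2t}^{2t} ≤ (2√2 t)^{2t} · ( E ‖P_{a+1,b} − E P_{a+1,b}‖_{2t}^{2t} + ‖E P_{a+1,b}‖_{2t}^{2t} + E ‖P_{a,b+1} − E P_{a,b+1}‖_{2t}^{2t} + ‖E P_{a,b+1}‖_{2t}^{2t} ). -/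

import Mathlib

open MeasureTheory ProbabilityTheory Matrix
open scoped BigOperators ENNReal

/-- Entrywise expectation of a random matrix. -/
noncomputable def matIntegral {Ω : Type*} [MeasurableSpace Ω] (μ : Measure Ω)
    {R C : Type*} (M : Ω → Matrix R C ℝ) : Matrix R C ℝ :=
  Matrix.of fun i j => ∫ ω, M ω i j ∂μ

/-- `schattenPow t A = tr ((AᴴA)^t) = ‖A‖_{2t}^{2t}`, the `2t`-th power of the Schatten
`2t`-norm of a real matrix `A`, defined for a real exponent `t` via the eigenvalues of
the Hermitian matrix `AᴴA`. -/
noncomputable def schattenPow {R C : Type*} [Fintype R] [Fintype C] [DecidableEq C]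
    (t : ℝ) (A : Matrix R C ℝ) : ℝ :=
  ∑ i, (Matrix.isHermitian_conjTranspose_mul_self A).eigenvalues i ^ t

/-- The Schatten `2t`-norm of a real matrix: `‖A‖_{2t} = (tr ((AᴴA)^t))^(1/(2t))`. -/
noncomputable def schattenNorm {R C : Type*} [Fintype R] [Fintype C] [DecidableEq C]
    (t : ℝ) (A : Matrix R C ℝ) : ℝ :=
  schattenPow t A ^ (2 * t)⁻¹
/-- Entrywise partial derivative of a matrix-valued function with respect to the
coordinate `v`. -/
noncomputable def pderivAt {ι : Type*} [Fintype ι] [DecidableEq ι] {R C : Type*}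
    (F : (ι → ℝ) → Matrix R C ℝ) (v : ι) : (ι → ℝ) → Matrix R C ℝ :=
  fun x => Matrix.of fun r c => fderiv ℝ (fun y => F y r c) x (Pi.single v 1)

/-- Iterated entrywise partial derivative along a tuple of coordinates. -/
noncomputable def iterPDeriv {ι : Type*} [Fintype ι] [DecidableEq ι] {R C : Type*}
    (F : (ι → ℝ) → Matrix R C ℝ) : {k : ℕ} → (Fin k → ι) → (ι → ℝ) → Matrix R C ℝ
  | 0, _ => F
  | _ + 1, w => pderivAt (iterPDeriv F fun j => w j.castSucc) (w (Fin.last _))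

/-- The partial-derivative block matrix `F_{a,b,c}`: rows carry the `a` vertically stacked
derivative directions, columns the `b` horizontally placed ones, and the `c` block-diagonal
directions appear in both (with the diagonal constraint). -/
noncomputable def derivBlocks {n : ℕ} {R C : Type*}
    (F : (Fin n → ℝ) → Matrix R C ℝ) (a b c : ℕ) :
    (Fin n → ℝ) →
      Matrix ((Fin a → Fin n) × (Fin c → Fin n) × R) ((Fin b → Fin n) × (Fin c → Fin n) × C) ℝ :=
  fun x => Matrix.of fun p q =>
    if p.2.1 = q.2.1 then
      iterPDeriv F (Fin.append (Fin.append p.1 q.1) p.2.1) x p.2.2 q.2.2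
    else 0

/-- The partial-derivative block matrix `F_{a,b}` (no diagonal blocks): rows carry the `a`
vertically stacked derivative directions and columns the `b` horizontally placed ones. -/
noncomputable def derivBlocks2 {ι : Type*} [Fintype ι] [DecidableEq ι] {R C : Type*}
    (F : (ι → ℝ) → Matrix R C ℝ) (a b : ℕ) :
    (ι → ℝ) → Matrix ((Fin a → ι) × R) ((Fin b → ι) × C) ℝ :=
  fun x => Matrix.of fun p q => iterPDeriv F (Fin.append p.1 q.1) x p.2 q.2


section MatFun
variable {m : Type*} [Fintype m] [DecidableEq m]

lemma mf_cont (f : ℝ → ℝ) (X : Matrix m m ℝ) : ContinuousOn f (spectrum ℝ X) :=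
  (Matrix.finite_real_spectrum (A := X)).continuousOn f

lemma mf_eq {X : Matrix m m ℝ} (hX : X.IsHermitian) (f : ℝ → ℝ) :
    cfc f X = (hX.eigenvectorUnitary : Matrix m m ℝ) * diagonal (f ∘ hX.eigenvalues) *
      (hX.eigenvectorUnitary : Matrix m m ℝ)ᵀ := by
  rw [hX.cfc_eq, Matrix.IsHermitian.cfc, Unitary.conjStarAlgAut_apply]
  rfl

lemma mf_mul {X : Matrix m m ℝ} (f g : ℝ → ℝ) :
    cfc f X * cfc g X = cfc (fun x => f x * g x) X :=
  (cfc_mul f g X (mf_cont f X) (mf_cont g X)).symm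

lemma mf_id {X : Matrix m m ℝ} (hX : X.IsHermitian) : cfc (fun x : ℝ => x) X = X :=
  cfc_id' ℝ X hX

lemma mf_one {X : Matrix m m ℝ} (hX : X.IsHermitian) : cfc (fun _ : ℝ => (1:ℝ)) X = 1 :=
  cfc_const_one ℝ X hX

lemma mf_trace {X : Matrix m m ℝ} (hX : X.IsHermitian) (f : ℝ → ℝ) :
    trace (cfc f X) = ∑ i, f (hX.eigenvalues i) := by
  rw [mf_eq hX, trace_mul_comm, ← mul_assoc]
  have : (hX.eigenvectorUnitary : Matrix m m ℝ)ᵀ * (hX.eigenvectorUnitary : Matrix m m ℝ) = 1 :=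
    Unitary.coe_star_mul_self hX.eigenvectorUnitary
  rw [this, one_mul, trace_diagonal]; rfl

/-- the weights -/
noncomputable def wt {X Y : Matrix m m ℝ} (hX : X.IsHermitian) (hY : Y.IsHermitian) (j k : m) : ℝ :=
  (((hX.eigenvectorUnitary : Matrix m m ℝ)ᵀ * (hY.eigenvectorUnitary : Matrix m m ℝ)) j k) ^ 2

lemma trace_mf_mul {X Y : Matrix m m ℝ} (hX : X.IsHermitian) (hY : Y.IsHermitian) (f g : ℝ → ℝ) :
    trace (cfc f X * cfc g Y) =
      ∑ j, ∑ k, f (hX.eigenvalues j) * g (hY.eigenvalues k) * wt hX hY j k := by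
  rw [mf_eq hX, mf_eq hY]
  set U := (hX.eigenvectorUnitary : Matrix m m ℝ)
  set V := (hY.eigenvectorUnitary : Matrix m m ℝ)
  have : trace (U * diagonal (f ∘ hX.eigenvalues) * Uᵀ * (V * diagonal (g ∘ hY.eigenvalues) * Vᵀ))
    = trace (diagonal (f ∘ hX.eigenvalues) * (Uᵀ * V) * (diagonal (g ∘ hY.eigenvalues) * (Uᵀ * V)ᵀ)) := by
    have e1 : U * diagonal (f ∘ hX.eigenvalues) * Uᵀ * (V * diagonal (g ∘ hY.eigenvalues) * Vᵀ)
      = U * (diagonal (f ∘ hX.eigenvalues) * Uᵀ * (V * diagonal (g ∘ hY.eigenvalues) * Vᵀ)) := by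
      simp only [mul_assoc]
    rw [e1, trace_mul_comm, transpose_mul, transpose_transpose]
    simp only [mul_assoc]
  rw [this]
  simp only [trace, diag]
  refine Finset.sum_congr rfl fun j _ => ?_
  rw [Matrix.mul_apply]
  refine Finset.sum_congr rfl fun k _ => ?_
  rw [diagonal_mul, diagonal_mul, transpose_apply]
  change _ = f (hX.eigenvalues j) * g (hY.eigenvalues k) * ((Uᵀ * V) j k) ^ 2
  simp only [Function.comp]; ring

lemma wt_nonneg {X Y : Matrix m m ℝ} (hX : X.IsHermitian) (hY : Y.IsHermitian) (j k : m) :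
    0 ≤ wt hX hY j k := sq_nonneg _

lemma mf_herm (f : ℝ → ℝ) (X : Matrix m m ℝ) : (cfc f X).IsHermitian :=
  IsSelfAdjoint.cfc (f := f) (a := X)

lemma mf_symm (f : ℝ → ℝ) (X : Matrix m m ℝ) (i j : m) : cfc f X i j = cfc f X j i := by
  have := (mf_herm f X).apply i j
  simpa using this.symm

lemma mf_poly {X : Matrix m m ℝ} (hX : X.IsHermitian) (q : Polynomial ℝ) :
    cfc (fun x => q.eval x) X = Polynomial.aeval X q :=
  cfc_polynomial q X hX

lemma mf_entry {X : Matrix m m ℝ} (hX : X.IsHermitian) (f : ℝ → ℝ) (a b : m) :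
    cfc f X a b = ∑ j, (hX.eigenvectorUnitary : Matrix m m ℝ) a j * f (hX.eigenvalues j) *
      (hX.eigenvectorUnitary : Matrix m m ℝ) b j := by
  rw [mf_eq hX, mul_apply]
  simp [mul_diagonal, transpose_apply]

lemma unit_entry_le (U : Matrix.unitaryGroup m ℝ) (a b : m) : |(U : Matrix m m ℝ) a b| ≤ 1 := by
  have := entry_norm_bound_of_unitary U.2 a b
  simpa using this

lemma eig_sq_le {X : Matrix m m ℝ} (hX : X.IsHermitian) (j : m) :
    (hX.eigenvalues j) ^ 2 ≤ ∑ a, ∑ b, X a b ^ 2 := by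
  have h1 : trace (cfc (fun x : ℝ => x * x) X) = ∑ a, ∑ b, X a b ^ 2 := by
    rw [← mf_mul (fun x => x) (fun x => x), mf_id hX]
    simp only [trace, diag, mul_apply]
    refine Finset.sum_congr rfl fun a _ => Finset.sum_congr rfl fun b _ => ?_
    have : X b a = X a b := by simpa using hX.apply a b
    rw [this]; ring
  rw [← h1, mf_trace hX]
  calc _ = (fun i => hX.eigenvalues i * hX.eigenvalues i) j := by simp [sq]
    _ ≤ _ := Finset.single_le_sum (f := fun i => hX.eigenvalues i * hX.eigenvalues i)
      (fun i _ => mul_self_nonneg _) (Finset.mem_univ j)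

lemma mf_entry_bound {X : Matrix m m ℝ} (hX : X.IsHermitian) (f : ℝ → ℝ) (K : ℕ)
    (hf : ∀ x, |f x| ≤ (1 + x ^ 2) ^ K) (a b : m) :
    |cfc f X a b| ≤ Fintype.card m * (1 + ∑ a, ∑ b, X a b ^ 2) ^ K := by
  rw [mf_entry hX]
  refine (Finset.abs_sum_le_sum_abs _ _).trans ?_
  rw [← nsmul_eq_mul]
  refine Finset.sum_le_card_nsmul _ _ _ fun j _ => ?_
  rw [abs_mul, abs_mul]
  have h1 := unit_entry_le hX.eigenvectorUnitary a j
  have h2 := unit_entry_le hX.eigenvectorUnitary b j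
  have h3 : |f (hX.eigenvalues j)| ≤ (1 + ∑ a, ∑ b, X a b ^ 2) ^ K := by
    refine (hf _).trans ?_
    have := eig_sq_le hX j
    gcongr
  have h4 : 0 ≤ (1 + ∑ a, ∑ b, X a b ^ 2) ^ K := (abs_nonneg _).trans h3
  calc _ ≤ 1 * (1 + ∑ a, ∑ b, X a b ^ 2) ^ K * 1 := by gcongr
    _ = _ := by ring

/-- polynomial approximation -/
lemma exists_poly_seq (f : ℝ → ℝ) (hf : Continuous f) :
    ∃ q : ℕ → Polynomial ℝ, ∀ x, Filter.Tendsto (fun k => (q k).eval x) Filter.atTop (nhds (f x)) := by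
  have : ∀ k : ℕ, ∃ q : Polynomial ℝ, ∀ x ∈ Set.Icc (-(k:ℝ)) k, |q.eval x - f x| < 1 / (k + 1) := 
    fun k => exists_polynomial_near_of_continuousOn _ _ f hf.continuousOn _ (by positivity)
  choose q hq using this
  refine ⟨q, fun x => ?_⟩
  rw [tendsto_iff_norm_sub_tendsto_zero]
  refine squeeze_zero' (Filter.Eventually.of_forall fun _ => norm_nonneg _) ?_
    tendsto_one_div_add_atTop_nhds_zero_nat
  filter_upwards [Filter.eventually_ge_atTop ⌈|x|⌉₊] with k hk
  have : |x| ≤ k := (Nat.le_ceil _).trans (by exact_mod_cast hk)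
  exact (hq k x (abs_le.1 this)).le

lemma mf_measurable {Ω : Type*} [MeasurableSpace Ω] (X : Ω → Matrix m m ℝ)
    (hX : ∀ ω, (X ω).IsHermitian) (hm : ∀ i j, Measurable fun ω => X ω i j)
    (f : ℝ → ℝ) (hf : Continuous f) (a b : m) : Measurable fun ω => cfc f (X ω) a b := by
  obtain ⟨q, hq⟩ := exists_poly_seq f hf
  have hpow : ∀ k : ℕ, ∀ a b, Measurable fun ω => (X ω ^ k) a b := by
    intro k
    induction k with
    | zero => intro a b; simp
    | succ k ih =>
      intro a b
      simp only [pow_succ, mul_apply]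
      exact Finset.measurable_sum _ fun j _ => (ih a j).mul (hm j b)
  refine measurable_of_tendsto_metrizable (f := fun k ω => Polynomial.aeval (X ω) (q k) a b) ?_ ?_
  · intro k
    simp only [Polynomial.aeval_eq_sum_range, Matrix.sum_apply, Matrix.smul_apply]
    exact Finset.measurable_sum _ fun j _ => (hpow j a b).const_mul _
  · rw [tendsto_pi_nhds]
    intro ω
    simp only [← mf_poly (hX ω), mf_entry (hX ω)]
    refine tendsto_finsetSum _ fun j _ => ?_
    exact ((hq _).const_mul _).mul_const _

end MatFun


section Scalar

lemma sc_young {s : ℝ} (hs : 1 < s) (x y : ℝ) (hx : 0 ≤ x) (hy : 0 ≤ y) :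
    s * (y ^ (s - 1) * x) ≤ (s - 1) * y ^ s + x ^ s := by
  have h1 : 0 < s - 1 := by linarith
  have hpq : (s / (s - 1)).HolderConjugate s := by
    exact (Real.HolderConjugate.conjExponent hs).symm
  have h2 := Real.young_inequality_of_nonneg (Real.rpow_nonneg hy (s - 1)) hx hpq
  rw [← Real.rpow_mul hy, mul_div_cancel₀ _ h1.ne'] at h2
  have h3 : y ^ s / (s / (s - 1)) + x ^ s / s = ((s - 1) * y ^ s + x ^ s) / s := by
    field_simp
  rw [h3, le_div_iff₀ (by linarith)] at h2
  linarith

lemma sc_abs_mul {s : ℝ} (hs : 1 < s) (y : ℝ) : |y| ^ (s - 2) * y * y = |y| ^ s := by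
  rw [mul_assoc, ← abs_mul_abs_self y]
  rcases eq_or_ne y 0 with rfl | h
  · simp; rw [Real.zero_rpow]; linarith
  · have h' : 0 < |y| := abs_pos.2 h
    rw [← sq, ← Real.rpow_natCast, ← Real.rpow_add h']; norm_num

lemma sc_klein {s : ℝ} (hs : 1 < s) (x y : ℝ) :
    |y| ^ s + s * (|y| ^ (s - 2) * y) * (x - y) ≤ |x| ^ s := by
  have h1 := sc_young hs |x| |y| (abs_nonneg _) (abs_nonneg _)
  have h2 := sc_abs_mul hs y
  have h3 : |y| ^ (s - 2) * y * x ≤ |y| ^ (s - 1) * |x| := by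
    refine (le_abs_self _).trans ?_
    rw [abs_mul, abs_mul, abs_of_nonneg (Real.rpow_nonneg (abs_nonneg y) _)]
    refine mul_le_mul_of_nonneg_right ?_ (abs_nonneg x)
    rcases eq_or_ne y 0 with rfl | h
    · simp; positivity
    · have h' : 0 < |y| := abs_pos.2 h
      nth_rw 2 [← Real.rpow_one |y|]
      rw [← Real.rpow_add h']; ring_nf; exact le_rfl
  nlinarith

lemma sc_mvt {r : ℝ} (hr : 2 ≤ r) (x y : ℝ) :
    (x - y) * (|x| ^ r * x - |y| ^ r * y) ≤ (r + 1) / 2 * (|x| ^ r + |y| ^ r) * (x - y) ^ 2 := by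
  set G : ℝ → ℝ := fun x => (r + 1) / 2 * (|x| ^ r + |y| ^ r) * (x - y) - (|x| ^ r * x - |y| ^ r * y)
  have hd : ∀ x, HasDerivAt G ((r + 1) / 2 * (|y| ^ r - (|x| ^ r + r * (|x| ^ (r - 2) * x) * (y - x)))) x := by
    intro x
    have h1 := hasDerivAt_abs_rpow x (show 1 < r by linarith)
    have h2 := (((h1.add_const (|y| ^ r)).const_mul ((r + 1) / 2)).mul ((hasDerivAt_id x).sub_const y)).sub
      ((h1.mul (hasDerivAt_id x)).sub_const (|y| ^ r * y))
    refine h2.congr_deriv ?_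
    have h3 := sc_abs_mul (show 1 < r by linarith) x
    simp only [id]
    linear_combination (-r) * h3
  have hm : Monotone G := by
    refine monotone_of_deriv_nonneg (fun x => (hd x).differentiableAt) fun x => ?_
    rw [(hd x).deriv]
    have := sc_klein (show 1 < r by linarith) y x
    have h0 : 0 ≤ (r + 1) / 2 := by linarith
    exact mul_nonneg h0 (by linarith)
  have hy : G y = 0 := by simp [G]
  have hG : 0 ≤ (x - y) * G x := by
    rcases le_total x y with h | h
    · exact mul_nonneg_of_nonpos_of_nonpos (by linarith) (by have := hm h; linarith)
    · exact mul_nonneg (by linarith) (by have := hm h; linarith)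
  simp only [G] at hG
  nlinarith

end Scalar

section Trace
variable {m : Type*} [Fintype m] [DecidableEq m]

/-- `|x|^r` -/
noncomputable def pf (r : ℝ) (x : ℝ) : ℝ := |x| ^ r
/-- `|x|^r x` -/
noncomputable def hf (r : ℝ) (x : ℝ) : ℝ := |x| ^ r * x

lemma tr_id_mul {X Y : Matrix m m ℝ} (hX : X.IsHermitian) (hY : Y.IsHermitian) (f : ℝ → ℝ) :
    trace (cfc f X) = ∑ j, ∑ k, f (hX.eigenvalues j) * wt hX hY j k := by
  have := trace_mf_mul hX hY f (fun _ => 1)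
  simpa [mf_one hY] using this

lemma tr_id_mul' {X Y : Matrix m m ℝ} (hX : X.IsHermitian) (hY : Y.IsHermitian) (f : ℝ → ℝ) :
    trace (cfc f Y) = ∑ j, ∑ k, f (hY.eigenvalues k) * wt hX hY j k := by
  have := trace_mf_mul hX hY (fun _ => 1) f
  simpa [mf_one hX] using this

lemma tr_klein {s : ℝ} (hs : 1 < s) {X Y : Matrix m m ℝ} (hX : X.IsHermitian) (hY : Y.IsHermitian) :
    trace (cfc (pf s) Y) + s * trace (cfc (hf (s - 2)) Y * (X - Y)) ≤ trace (cfc (pf s) X) := by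
  have e1 : trace (cfc (hf (s - 2)) Y * X) = ∑ j, ∑ k, hX.eigenvalues j * hf (s-2) (hY.eigenvalues k) * wt hX hY j k := by
    rw [trace_mul_comm]; nth_rw 1 [← mf_id hX]
    exact trace_mf_mul hX hY (fun x => x) _
  have e2 : trace (cfc (hf (s - 2)) Y * Y) =
      ∑ j, ∑ k, (hf (s-2) (hY.eigenvalues k) * hY.eigenvalues k) * wt hX hY j k := by
    nth_rw 2 [← mf_id hY]
    rw [mf_mul]; exact tr_id_mul' hX hY _
  rw [mul_sub, trace_sub, e1, e2, tr_id_mul' hX hY, tr_id_mul hX hY]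
  simp only [← Finset.sum_sub_distrib, Finset.mul_sum, ← Finset.sum_add_distrib]
  refine Finset.sum_le_sum fun j _ => Finset.sum_le_sum fun k _ => ?_
  have := mul_le_mul_of_nonneg_right (sc_klein hs (hX.eigenvalues j) (hY.eigenvalues k)) (wt_nonneg hX hY j k)
  simp only [pf, hf] at *
  linarith

lemma tr_mvt {r : ℝ} (hr : 2 ≤ r) {X Y : Matrix m m ℝ} (hX : X.IsHermitian) (hY : Y.IsHermitian) :
    trace (cfc (hf r) X * X) - trace (cfc (hf r) X * Y) - trace (cfc (hf r) Y * X)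
      + trace (cfc (hf r) Y * Y) ≤
    (r + 1) / 2 * (trace (cfc (pf r) X * ((X - Y) * (X - Y)))
      + trace (cfc (pf r) Y * ((X - Y) * (X - Y)))) := by
  have xx : X * X = cfc (fun x : ℝ => x * x) X := by
    rw [← mf_mul (fun x => x) (fun x => x), mf_id hX]
  have yy : Y * Y = cfc (fun x : ℝ => x * x) Y := by
    rw [← mf_mul (fun x => x) (fun x => x), mf_id hY]
  have e1 : trace (cfc (hf r) X * X) = ∑ j, ∑ k, (hf r (hX.eigenvalues j) * hX.eigenvalues j) * wt hX hY j k := by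
    nth_rw 2 [← mf_id hX]
    rw [mf_mul]; exact tr_id_mul hX hY _
  have e2 : trace (cfc (hf r) X * Y) = ∑ j, ∑ k, (hf r (hX.eigenvalues j)) * hY.eigenvalues k * wt hX hY j k := by
    nth_rw 1 [← mf_id hY]
    exact trace_mf_mul hX hY _ (fun x => x)
  have e3 : trace (cfc (hf r) Y * X) = ∑ j, ∑ k, hX.eigenvalues j * hf r (hY.eigenvalues k) * wt hX hY j k := by
    rw [trace_mul_comm]; nth_rw 1 [← mf_id hX]
    exact trace_mf_mul hX hY (fun x => x) _
  have e4 : trace (cfc (hf r) Y * Y) = ∑ j, ∑ k, (hf r (hY.eigenvalues k) * hY.eigenvalues k) * wt hX hY j k := by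
    nth_rw 2 [← mf_id hY]
    rw [mf_mul]; exact tr_id_mul' hX hY _
  have f1 : trace (cfc (pf r) X * ((X - Y) * (X - Y))) = ∑ j, ∑ k,
      (pf r (hX.eigenvalues j) * (hX.eigenvalues j - hY.eigenvalues k) ^ 2) * wt hX hY j k := by
    have : cfc (pf r) X * ((X - Y) * (X - Y)) = cfc (pf r) X * (X * X) - (cfc (pf r) X * X) * Y
        - cfc (pf r) X * (Y * X) + cfc (pf r) X * (Y * Y) := by noncomm_ring
    rw [this, trace_add, trace_sub, trace_sub, ← mul_assoc _ Y X, trace_mul_comm (cfc (pf r) X * Y) X,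
      ← mul_assoc X]
    have c1 : cfc (pf r) X * X = cfc (fun x => pf r x * x) X := by
      nth_rw 2 [← mf_id hX]; rw [mf_mul]
    have c2 : X * cfc (pf r) X = cfc (fun x => x * pf r x) X := by
      nth_rw 1 [← mf_id hX]; rw [mf_mul]
    rw [c1, c2, xx, yy, mf_mul, tr_id_mul hX hY, trace_mf_mul hX hY]
    have g1 := trace_mf_mul hX hY (fun x => pf r x * x) (fun x => x)
    have g2 := trace_mf_mul hX hY (fun x => x * pf r x) (fun x => x)
    rw [mf_id hY] at g1 g2
    rw [g1, g2]
    simp only [← Finset.sum_sub_distrib, ← Finset.sum_add_distrib]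
    refine Finset.sum_congr rfl fun j _ => Finset.sum_congr rfl fun k _ => ?_
    ring
  have f2 : trace (cfc (pf r) Y * ((X - Y) * (X - Y))) = ∑ j, ∑ k,
      (pf r (hY.eigenvalues k) * (hX.eigenvalues j - hY.eigenvalues k) ^ 2) * wt hX hY j k := by
    have : cfc (pf r) Y * ((X - Y) * (X - Y)) = cfc (pf r) Y * (X * X) - (cfc (pf r) Y * X) * Y
        - cfc (pf r) Y * Y * X + cfc (pf r) Y * (Y * Y) := by noncomm_ring
    rw [this, trace_add, trace_sub, trace_sub, trace_mul_comm (cfc (pf r) Y * X) Y,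
      ← mul_assoc Y]
    have c1 : cfc (pf r) Y * Y = cfc (fun x => pf r x * x) Y := by
      nth_rw 2 [← mf_id hY]; rw [mf_mul]
    have c2 : Y * cfc (pf r) Y = cfc (fun x => x * pf r x) Y := by
      nth_rw 1 [← mf_id hY]; rw [mf_mul]
    rw [c1, c2, xx, yy, mf_mul, tr_id_mul' hX hY, trace_mul_comm, trace_mf_mul hX hY,
      trace_mul_comm _ X, trace_mul_comm _ X]
    have g1 := trace_mf_mul hX hY (fun x => x) (fun x => pf r x * x)
    have g2 := trace_mf_mul hX hY (fun x => x) (fun x => x * pf r x)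
    rw [mf_id hX] at g1 g2
    rw [g1, g2]
    simp only [← Finset.sum_sub_distrib, ← Finset.sum_add_distrib]
    refine Finset.sum_congr rfl fun j _ => Finset.sum_congr rfl fun k _ => ?_
    ring
  rw [e1, e2, e3, e4, f1, f2]
  simp only [← Finset.sum_sub_distrib, ← Finset.sum_add_distrib, Finset.mul_sum]
  refine Finset.sum_le_sum fun j _ => Finset.sum_le_sum fun k _ => ?_
  have := mul_le_mul_of_nonneg_right (sc_mvt hr (hX.eigenvalues j) (hY.eigenvalues k)) (wt_nonneg hX hY j k)
  simp only [pf, hf] at *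
  linarith

lemma tr_young {t : ℝ} (ht : 1 < t) {X G : Matrix m m ℝ} (hX : X.IsHermitian) (hG : G.PosSemidef)
    {c : ℝ} (hc : 0 ≤ c) :
    t * (c * trace (cfc (pf (2 * t - 2)) X * G)) ≤
      (t - 1) * trace (cfc (pf (2 * t)) X) + c ^ t * trace (cfc (fun x : ℝ => x ^ t) G) := by
  have hH := hG.isHermitian
  have e1 : trace (cfc (pf (2 * t - 2)) X * G) = ∑ j, ∑ k,
      pf (2 * t - 2) (hX.eigenvalues j) * hH.eigenvalues k * wt hX hH j k := by
    nth_rw 1 [← mf_id hH]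
    exact trace_mf_mul hX hH _ (fun x => x)
  rw [e1, tr_id_mul hX hH, tr_id_mul' hX hH]
  simp only [← Finset.sum_add_distrib, Finset.mul_sum]
  refine Finset.sum_le_sum fun j _ => Finset.sum_le_sum fun k _ => ?_
  have hk := hG.eigenvalues_nonneg k
  have := mul_le_mul_of_nonneg_right (sc_young ht (c * hH.eigenvalues k) (|hX.eigenvalues j| ^ (2:ℝ))
    (mul_nonneg hc hk) (by positivity)) (wt_nonneg hX hH j k)
  rw [Real.mul_rpow hc hk, ← Real.rpow_mul (abs_nonneg _), ← Real.rpow_mul (abs_nonneg _), mul_sub, mul_one] at this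
  simp only [pf]
  linarith

lemma exists_poly_agree (f : ℝ → ℝ) (S : Finset ℝ) : ∃ q : Polynomial ℝ, ∀ x ∈ S, q.eval x = f x := by
  refine ⟨Lagrange.interpolate S id f, fun x hx => ?_⟩
  have := Lagrange.eval_interpolate_at_node (s := S) (v := id) f (Set.injOn_id _) hx
  simpa using this

lemma mf_eq_aeval {X : Matrix m m ℝ} (hX : X.IsHermitian) (f : ℝ → ℝ) (q : Polynomial ℝ)
    (h : ∀ x ∈ spectrum ℝ X, q.eval x = f x) : cfc f X = Polynomial.aeval X q := by
  rw [← mf_poly hX]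
  exact cfc_congr fun x hx => (h x hx).symm

end Trace

section Blocks
variable {R C : Type*} [Fintype R] [Fintype C] [DecidableEq R] [DecidableEq C]

lemma aeval_blocks (A : Matrix R R ℝ) (B : Matrix C C ℝ) (q : Polynomial ℝ) :
    Polynomial.aeval (fromBlocks A 0 0 B) q = fromBlocks (Polynomial.aeval A q) 0 0 (Polynomial.aeval B q) := by
  induction q using Polynomial.induction_on' with
  | add p q hp hq => simp [hp, hq, fromBlocks_add]
  | monomial n a =>
    have : ∀ n : ℕ, (fromBlocks A 0 0 B) ^ n = fromBlocks (A ^ n) 0 0 (B ^ n) := by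
      intro n
      induction n with
      | zero => simp
      | succ n ih => simp [pow_succ, ih, fromBlocks_multiply]
    simp only [← Polynomial.C_mul_X_pow_eq_monomial, map_mul, map_pow, Polynomial.aeval_X, Polynomial.aeval_C, this]
    simp only [← Algebra.smul_def, fromBlocks_smul, smul_zero]

lemma trace_mf_blocks {A : Matrix R R ℝ} {B : Matrix C C ℝ} (hA : A.IsHermitian) (hB : B.IsHermitian)
    (f : ℝ → ℝ) : trace (cfc f (fromBlocks A 0 0 B)) = trace (cfc f A) + trace (cfc f B) := by
  have hM : (fromBlocks A 0 0 B).IsHermitian := by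
    rw [Matrix.isHermitian_fromBlocks_iff]; exact ⟨hA, by simp, by simp, hB⟩
  classical
  obtain ⟨q, hq⟩ := exists_poly_agree f ((finite_real_spectrum (A := A)).toFinset ∪
    (finite_real_spectrum (A := B)).toFinset ∪ (finite_real_spectrum (A := fromBlocks A 0 0 B)).toFinset)
  rw [mf_eq_aeval hA f q fun x hx => hq x (by simp [hx]),
    mf_eq_aeval hB f q fun x hx => hq x (by simp [hx]),
    mf_eq_aeval hM f q fun x hx => hq x (by simp [hx]), aeval_blocks]
  simp [trace, Fintype.sum_sum_type]

omit [Fintype C] [DecidableEq R] [DecidableEq C] in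
lemma herm_tmul (A : Matrix R C ℝ) : (Aᵀ * A).IsHermitian := by
  simpa using Matrix.isHermitian_conjTranspose_mul_self A

omit [Fintype R] [DecidableEq R] [DecidableEq C] in
lemma herm_mult (A : Matrix R C ℝ) : (A * Aᵀ).IsHermitian := by
  simpa using Matrix.isHermitian_mul_conjTranspose_self A

lemma trace_mf_comm (A : Matrix R C ℝ) (f : ℝ → ℝ) (f0 : f 0 = 0) :
    trace (cfc f (Aᵀ * A)) = trace (cfc f (A * Aᵀ)) := by
  classical
  obtain ⟨q, hq⟩ := exists_poly_agree f (insert 0 ((finite_real_spectrum (A := Aᵀ * A)).toFinset ∪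
    (finite_real_spectrum (A := A * Aᵀ)).toFinset))
  rw [mf_eq_aeval (herm_tmul A) f q fun x hx => hq x (by simp [hx]),
    mf_eq_aeval (herm_mult A) f q fun x hx => hq x (by simp [hx])]
  have h0 : q.coeff 0 = 0 := by
    rw [Polynomial.coeff_zero_eq_eval_zero, hq 0 (by simp), f0]
  rw [Polynomial.aeval_eq_sum_range, Polynomial.aeval_eq_sum_range, trace_sum, trace_sum]
  refine Finset.sum_congr rfl fun k _ => ?_
  rw [trace_smul, trace_smul]
  cases k with
  | zero => simp [h0]
  | succ k =>
    congr 1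
    have : ∀ k : ℕ, A * (Aᵀ * A) ^ k = (A * Aᵀ) ^ k * A := by
      intro k
      induction k with
      | zero => simp
      | succ k ih => rw [pow_succ, ← Matrix.mul_assoc, ih, pow_succ]; simp only [Matrix.mul_assoc]
    rw [pow_succ', Matrix.mul_assoc, trace_mul_comm, this, pow_succ, Matrix.mul_assoc]

end Blocks


section Phi
variable {R C : Type*} [Fintype R] [Fintype C] [DecidableEq R] [DecidableEq C]

omit [DecidableEq R] in
lemma sp_eq (t : ℝ) (A : Matrix R C ℝ) :
    schattenPow t A = trace (cfc (fun x : ℝ => x ^ t) (Aᵀ * A)) := by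
  have := mf_trace (Matrix.isHermitian_conjTranspose_mul_self A) (fun x : ℝ => x ^ t)
  rw [schattenPow, ← this, conjTranspose_eq_transpose_of_trivial]

lemma sp_eq' {t : ℝ} (ht : 0 < t) (A : Matrix R C ℝ) :
    schattenPow t A = trace (cfc (fun x : ℝ => x ^ t) (A * Aᵀ)) := by
  rw [sp_eq, trace_mf_comm]; exact Real.zero_rpow ht.ne'

omit [DecidableEq R] in
lemma sp_nonneg (t : ℝ) (A : Matrix R C ℝ) : 0 ≤ schattenPow t A := by
  rw [schattenPow]
  exact Finset.sum_nonneg fun i _ => Real.rpow_nonneg (Matrix.eigenvalues_conjTranspose_mul_self_nonneg A i) _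

/-- dilation -/
def dil (A : Matrix R C ℝ) : Matrix (R ⊕ C) (R ⊕ C) ℝ := fromBlocks 0 A Aᵀ 0

omit [Fintype R] [Fintype C] [DecidableEq R] [DecidableEq C] in
lemma dil_herm (A : Matrix R C ℝ) : (dil A).IsHermitian := by
  rw [dil, Matrix.isHermitian_fromBlocks_iff]
  exact ⟨by simp, by simp, by simp, by simp⟩

omit [DecidableEq R] [DecidableEq C] in
lemma dil_sq (A : Matrix R C ℝ) : dil A * dil A = fromBlocks (A * Aᵀ) 0 0 (Aᵀ * A) := by
  simp [dil, fromBlocks_multiply]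

lemma psi_dil {t : ℝ} (ht : 0 < t) (A : Matrix R C ℝ) :
    trace (cfc (pf (2 * t)) (dil A)) = 2 * schattenPow t A := by
  have h1 : cfc (pf (2 * t)) (dil A) = cfc (fun x : ℝ => x ^ t) (dil A * dil A) := by
    have h2 : dil A * dil A = cfc (fun x : ℝ => x * x) (dil A) := by
      rw [← mf_mul (fun x => x) (fun x => x), mf_id (dil_herm A)]
    have h3 : pf (2 * t) = fun x : ℝ => (x * x) ^ t := by
      funext x
      rw [pf, Real.rpow_mul (abs_nonneg x), ← abs_mul_abs_self x]; norm_num [sq]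
    rw [h2, h3]
    refine cfc_comp' (fun x : ℝ => x ^ t) (fun x : ℝ => x * x) (dil A) ?_ ?_ (dil_herm A)
    · exact ((finite_real_spectrum (A := dil A)).image _).continuousOn _
    · exact mf_cont _ _
  rw [h1, dil_sq, trace_mf_blocks (herm_mult A) (herm_tmul A), ← sp_eq, ← sp_eq' ht]
  ring

omit [DecidableEq R] [DecidableEq C] in
lemma trace_mul_dil (K : Matrix (R ⊕ C) (R ⊕ C) ℝ) (E : Matrix R C ℝ) :
    trace (K * dil E) = ∑ r, ∑ c, (K (.inr c) (.inl r) + K (.inl r) (.inr c)) * E r c := by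
  simp only [trace, diag, Matrix.mul_apply, Fintype.sum_sum_type, dil, fromBlocks_apply₁₁,
    fromBlocks_apply₁₂, fromBlocks_apply₂₁, fromBlocks_apply₂₂, Matrix.zero_apply, mul_zero,
    Finset.sum_const_zero, zero_add, add_zero, transpose_apply]
  rw [Finset.sum_comm (s := (Finset.univ : Finset C)), ← Finset.sum_add_distrib]
  refine Finset.sum_congr rfl fun r _ => ?_
  rw [← Finset.sum_add_distrib]
  refine Finset.sum_congr rfl fun c _ => ?_
  ring

lemma sp_subgrad {t : ℝ} (ht : 1 ≤ t) (A : Matrix R C ℝ) :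
    ∃ G : Matrix R C ℝ, ∀ B : Matrix R C ℝ,
      schattenPow t A + ∑ r, ∑ c, G r c * (B r c - A r c) ≤ schattenPow t B := by
  set K := cfc (hf (2 * t - 2)) (dil A)
  refine ⟨fun r c => t * (K (.inr c) (.inl r) + K (.inl r) (.inr c)), fun B => ?_⟩
  have h := tr_klein (s := 2 * t) (by linarith) (dil_herm B) (dil_herm A)
  rw [psi_dil (by linarith), psi_dil (by linarith)] at h
  have h2 : dil B - dil A = dil (B - A) := by
    simp [dil, sub_eq_add_neg, fromBlocks_add, fromBlocks_neg]
  rw [h2, trace_mul_dil] at h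
  have h3 : ∑ r, ∑ c, t * (K (.inr c) (.inl r) + K (.inl r) (.inr c)) * (B r c - A r c)
    = t * ∑ r, ∑ c, (K (.inr c) (.inl r) + K (.inl r) (.inr c)) * (B - A) r c := by
    simp only [Finset.mul_sum, Matrix.sub_apply, mul_assoc]
  simp only [h3]
  nlinarith

omit [DecidableEq R] in
lemma sp_smul (t : ℝ) {c : ℝ} (hc : 0 ≤ c) (A : Matrix R C ℝ) :
    schattenPow t (c • A) = c ^ (2 * t) * schattenPow t A := by
  have hA := herm_tmul A
  have h1 : (c • A)ᵀ * (c • A) = cfc (fun x : ℝ => c ^ 2 * x) (Aᵀ * A) := by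
    have := cfc_const_mul (c ^ 2) (fun x : ℝ => x) (Aᵀ * A) (mf_cont _ _)
    rw [this, mf_id hA]
    simp [smul_smul, sq]
  have h2 : cfc (fun x : ℝ => x ^ t) (cfc (fun x : ℝ => c ^ 2 * x) (Aᵀ * A))
      = cfc (fun x : ℝ => (c ^ 2 * x) ^ t) (Aᵀ * A) := by
    refine (cfc_comp' (fun x : ℝ => x ^ t) (fun x : ℝ => c ^ 2 * x) (Aᵀ * A) ?_ ?_ hA).symm
    · exact ((finite_real_spectrum (A := Aᵀ * A)).image _).continuousOn _
    · exact mf_cont _ _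
  rw [sp_eq, h1, h2, mf_trace hA, sp_eq, mf_trace hA, Finset.mul_sum]
  refine Finset.sum_congr rfl fun i _ => ?_
  have h3 : 0 ≤ hA.eigenvalues i := by
    have : (Aᵀ * A).PosSemidef := by simpa using Matrix.posSemidef_conjTranspose_mul_self A
    exact this.eigenvalues_nonneg i
  rw [Real.mul_rpow (by positivity) h3, Real.rpow_mul hc]; norm_num

lemma sp_add_le {t : ℝ} (ht : 1 ≤ t) (A B : Matrix R C ℝ) :
    schattenPow t (A + B) ≤ 2 ^ (2 * t) / 2 * (schattenPow t A + schattenPow t B) := by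
  obtain ⟨G, hG⟩ := sp_subgrad ht ((1 / 2 : ℝ) • (A + B))
  have h1 := hG A
  have h2 := hG B
  have h3 : A + B = (2:ℝ) • ((1 / 2 : ℝ) • (A + B)) := by rw [smul_smul]; norm_num
  rw [h3, sp_smul t (by norm_num)]
  have h4 : ∑ r, ∑ c, G r c * (A r c - ((1 / 2 : ℝ) • (A + B)) r c) +
    ∑ r, ∑ c, G r c * (B r c - ((1 / 2 : ℝ) • (A + B)) r c) = 0 := by
    rw [← Finset.sum_add_distrib]
    refine Finset.sum_eq_zero fun r _ => ?_
    rw [← Finset.sum_add_distrib]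
    refine Finset.sum_eq_zero fun c _ => ?_
    simp; ring
  have : 2 * schattenPow t ((1 / 2 : ℝ) • (A + B)) ≤ schattenPow t A + schattenPow t B := by linarith
  have h5 : (0:ℝ) < 2 ^ (2 * t) := by positivity
  nlinarith

end Phi

section Good
variable {Ω : Type*} [MeasurableSpace Ω]

/-- measurable with all moments -/
def Good (ν : Measure Ω) (F : Ω → ℝ) : Prop := Measurable F ∧ ∀ p : ℕ, MemLp F p ν

variable {ν : Measure Ω} {F G : Ω → ℝ}

lemma Good.const [IsFiniteMeasure ν] (c : ℝ) : Good ν fun _ => c :=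
  ⟨measurable_const, fun _ => memLp_const c⟩
lemma Good.add (hF : Good ν F) (hG : Good ν G) : Good ν fun x => F x + G x :=
  ⟨hF.1.add hG.1, fun p => (hF.2 p).add (hG.2 p)⟩
lemma Good.sub (hF : Good ν F) (hG : Good ν G) : Good ν fun x => F x - G x :=
  ⟨hF.1.sub hG.1, fun p => (hF.2 p).sub (hG.2 p)⟩
lemma Good.mul (hF : Good ν F) (hG : Good ν G) : Good ν fun x => F x * G x := by
  refine ⟨hF.1.mul hG.1, fun p => ?_⟩
  have : ENNReal.HolderTriple (2 * p : ℕ) (2 * p : ℕ) p := by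
    constructor
    rw [← two_mul]; push_cast
    rw [ENNReal.mul_inv (by simp) (by simp), ← mul_assoc, ENNReal.mul_inv_cancel (by simp) (by simp), one_mul]
  exact (hG.2 (2 * p)).mul' (hF.2 (2 * p))
lemma Good.sum {ι : Type*} (s : Finset ι) {F : ι → Ω → ℝ} [IsFiniteMeasure ν] (h : ∀ i ∈ s, Good ν (F i)) :
    Good ν fun x => ∑ i ∈ s, F i x :=
  ⟨Finset.measurable_sum _ fun i hi => (h i hi).1, fun p => memLp_finsetSum _ fun i hi => (h i hi).2 p⟩
lemma Good.pow [IsFiniteMeasure ν] (hF : Good ν F) (k : ℕ) : Good ν fun x => F x ^ k := by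
  induction k with
  | zero => simpa using Good.const 1
  | succ k ih => simp only [pow_succ]; exact ih.mul hF
lemma Good.mono (hF : Good ν F) (hG : Measurable G) (h : ∀ x, |G x| ≤ F x) : Good ν G :=
  ⟨hG, fun p => (hF.2 p).mono hG.aestronglyMeasurable
    (Filter.Eventually.of_forall fun x => (h x).trans (le_abs_self _))⟩
lemma Good.integrable (hF : Good ν F) : Integrable F ν := by
  have := hF.2 1
  rwa [Nat.cast_one, memLp_one_iff_integrable] at this
lemma Good.comp {Ω' : Type*} [MeasurableSpace Ω'] {ν' : Measure Ω'} {T : Ω' → Ω}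
    (hF : Good ν F) (hT : MeasurePreserving T ν' ν) : Good ν' fun x => F (T x) :=
  ⟨hF.1.comp hT.measurable, fun p => (hF.2 p).comp_measurePreserving hT⟩

variable {m : Type*} [Fintype m] [DecidableEq m] [IsFiniteMeasure ν]

lemma Good.mf {X : Ω → Matrix m m ℝ} (hX : ∀ ω, (X ω).IsHermitian)
    (hg : ∀ i j, Good ν fun ω => X ω i j) {f : ℝ → ℝ} (hf : Continuous f) (K : ℕ)
    (hK : ∀ x, |f x| ≤ (1 + x ^ 2) ^ K) (a b : m) : Good ν fun ω => cfc f (X ω) a b := by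
  refine Good.mono (F := fun ω => Fintype.card m * (1 + ∑ a, ∑ b, X ω a b ^ 2) ^ K) ?_
    (mf_measurable X hX (fun i j => (hg i j).1) f hf a b) (fun ω => mf_entry_bound (hX ω) f K hK a b)
  exact (Good.const _).mul (((Good.const _).add (Good.sum _ fun a _ => Good.sum _ fun b _ => (hg a b).pow 2)).pow K)

omit [DecidableEq m] in
lemma Good.matmul {l o : Type*} {X : Ω → Matrix l m ℝ} {Y : Ω → Matrix m o ℝ}
    (hX : ∀ i j, Good ν fun ω => X ω i j) (hY : ∀ i j, Good ν fun ω => Y ω i j) (i : l) (j : o) :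
    Good ν fun ω => (X ω * Y ω) i j := by
  simp only [Matrix.mul_apply]
  exact Good.sum _ fun k _ => (hX i k).mul (hY k j)

omit [DecidableEq m] in
lemma Good.trace {X : Ω → Matrix m m ℝ} (hX : ∀ i j, Good ν fun ω => X ω i j) :
    Good ν fun ω => trace (X ω) := by
  simp only [Matrix.trace, diag]
  exact Good.sum _ fun k _ => hX k k

lemma abs_rpow_bound {r : ℝ} (hr : 0 ≤ r) (x : ℝ) : |x| ^ r ≤ (1 + x ^ 2) ^ ⌈r⌉₊ := by
  have h1 : |x| ≤ 1 + x ^ 2 := by nlinarith [sq_abs x, sq_nonneg (|x| - 1)]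
  calc |x| ^ r ≤ (1 + x ^ 2) ^ r := Real.rpow_le_rpow (abs_nonneg x) h1 hr
    _ ≤ (1 + x ^ 2) ^ (⌈r⌉₊ : ℝ) := Real.rpow_le_rpow_of_exponent_le (by nlinarith [sq_nonneg x]) (Nat.le_ceil r)
    _ = _ := Real.rpow_natCast _ _

lemma Good.mf_pf {r : ℝ} (hr : 0 ≤ r) {X : Ω → Matrix m m ℝ} (hX : ∀ ω, (X ω).IsHermitian)
    (hg : ∀ i j, Good ν fun ω => X ω i j) (a b : m) : Good ν fun ω => cfc (pf r) (X ω) a b := by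
  refine Good.mf hX hg ?_ ⌈r⌉₊ (fun x => ?_) a b
  · exact continuous_abs.rpow_const fun _ => Or.inr hr
  · rw [pf, abs_of_nonneg (Real.rpow_nonneg (abs_nonneg x) r)]; exact abs_rpow_bound hr x

lemma Good.mf_hf {r : ℝ} (hr : 0 ≤ r) {X : Ω → Matrix m m ℝ} (hX : ∀ ω, (X ω).IsHermitian)
    (hg : ∀ i j, Good ν fun ω => X ω i j) (a b : m) : Good ν fun ω => cfc (hf r) (X ω) a b := by
  refine Good.mf hX hg ?_ (⌈r⌉₊ + 1) (fun x => ?_) a b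
  · exact (continuous_abs.rpow_const fun _ => Or.inr hr).mul continuous_id
  · rw [hf, abs_mul, abs_of_nonneg (Real.rpow_nonneg (abs_nonneg x) r), pow_succ]
    have h1 : |x| ≤ 1 + x ^ 2 := by nlinarith [sq_abs x, sq_nonneg (|x| - 1)]
    exact mul_le_mul (abs_rpow_bound hr x) h1 (abs_nonneg _) (by positivity)

lemma Good.sp {R C : Type*} [Fintype R] [Fintype C] [DecidableEq C] {t : ℝ} (ht : 0 ≤ t)
    {A : Ω → Matrix R C ℝ} (hA : ∀ i j, Good ν fun ω => A ω i j) : Good ν fun ω => schattenPow t (A ω) := by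
  simp only [sp_eq]
  refine Good.trace fun i j => ?_
  refine Good.mf (fun ω => herm_tmul _) ?_ (Real.continuous_rpow_const ht) ⌈t⌉₊ (fun x => ?_) i j
  · exact Good.matmul (fun i j => hA j i) hA
  · exact (Real.abs_rpow_le_abs_rpow x t).trans (abs_rpow_bound ht x)

end Good


section Gauss
variable {n : ℕ}

/-- standard Gaussian -/
noncomputable abbrev gam (n : ℕ) : Measure (Fin n → ℝ) := Measure.pi fun _ => gaussianReal 0 1

lemma gam_mp (i : Fin n) : MeasurePreserving (fun x : Fin n → ℝ => x i) (gam n) (gaussianReal 0 1) :=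
  measurePreserving_eval (fun _ : Fin n => gaussianReal 0 1) i

lemma gam_good (i : Fin n) : Good (gam n) fun x => x i :=
  ⟨measurable_pi_apply i, fun p => (memLp_id_gaussianReal' (p : ℝ≥0∞) (by simp)).comp_measurePreserving (gam_mp i)⟩

lemma gam_int (i : Fin n) : ∫ x, x i ∂(gam n) = 0 := by
  have h := (gam_mp i).map_eq
  have h2 : ∫ x, x ∂(gaussianReal 0 1) = 0 := integral_id_gaussianReal
  rw [← h, integral_map (measurable_pi_apply i).aemeasurable (by fun_prop)] at h2
  exact h2

lemma gam_int_sq (i : Fin n) : ∫ x, x i * x i ∂(gam n) = 1 := by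
  have h := (gam_mp i).map_eq
  have h2 : ∫ x, x * x ∂(gaussianReal 0 1) = 1 := by
    have := variance_id_gaussianReal (μ := 0) (v := 1)
    rw [variance_of_integral_eq_zero (by fun_prop) (by simp)] at this
    simpa [sq] using this
  rw [← h, integral_map (measurable_pi_apply i).aemeasurable (by fun_prop)] at h2
  exact h2

lemma gam_indep : iIndepFun (fun (i : Fin n) (x : Fin n → ℝ) => x i) (gam n) :=
  iIndepFun_pi (X := fun _ : Fin n => (id : ℝ → ℝ)) (fun _ => aemeasurable_id)

lemma gam_int_mul (i j : Fin n) : ∫ x, x i * x j ∂(gam n) = if i = j then 1 else 0 := by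
  split_ifs with h
  · subst h; exact gam_int_sq i
  · have := (gam_indep.indepFun h).integral_fun_mul_eq_mul_integral
      (measurable_pi_apply i).aestronglyMeasurable (measurable_pi_apply j).aestronglyMeasurable
    rw [this, gam_int, zero_mul]

lemma gam_isGaussian : IsGaussian (gam n) := by
  have h := (gam_indep (n := n)).hasGaussianLaw (fun i => ⟨by rw [(gam_mp i).map_eq]; infer_instance⟩)
  have h2 := h.isGaussian_map
  have h3 : (fun (ω : Fin n → ℝ) (i : Fin n) => ω i) = id := rfl
  rw [h3, Measure.map_id] at h2
  exact h2

lemma gam_rot (θ : ℝ) : MeasurePreserving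
    (fun z : (Fin n → ℝ) × (Fin n → ℝ) =>
      (Real.cos θ • z.1 + Real.sin θ • z.2, -Real.sin θ • z.1 + Real.cos θ • z.2))
    ((gam n).prod (gam n)) ((gam n).prod (gam n)) := by
  have := gam_isGaussian (n := n)
  refine ⟨by fun_prop, ?_⟩
  refine IsGaussian.map_rotation_eq_self (μ := gam n) ?_ θ
  ext i
  have := IsGaussian.integrable_id (μ := gam n)
  have h2 : (∫ x, id x ∂(gam n)) i = ∫ x : Fin n → ℝ, x i ∂(gam n) :=
    eval_integral (μ := gam n) (f := fun x : Fin n → ℝ => id x) (fun i => (gam_good i).integrable) i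
  rw [h2, gam_int]; rfl

lemma gam_refl (θ : ℝ) : MeasurePreserving
    (fun z : (Fin n → ℝ) × (Fin n → ℝ) =>
      (Real.cos θ • z.1 + Real.sin θ • z.2, Real.sin θ • z.1 - Real.cos θ • z.2))
    ((gam n).prod (gam n)) ((gam n).prod (gam n)) := by
  have h := (gam_rot (n := n) (Real.pi / 2 - θ)).comp
    (Measure.measurePreserving_swap (μ := gam n) (ν := gam n))
  convert h using 1
  funext z
  simp only [Function.comp, Prod.fst_swap, Prod.snd_swap, Real.cos_pi_div_two_sub, Real.sin_pi_div_two_sub]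
  ext i <;> simp <;> ring

lemma good_fst {F : (Fin n → ℝ) → ℝ} (h : Good (gam n) F) :
    Good ((gam n).prod (gam n)) fun z => F z.1 := h.comp measurePreserving_fst
lemma good_snd {F : (Fin n → ℝ) → ℝ} (h : Good (gam n) F) :
    Good ((gam n).prod (gam n)) fun z => F z.2 := h.comp measurePreserving_snd

variable {m : Type*} [Fintype m] [DecidableEq m]

/-- linear combination -/
def lc (B : Fin n → Matrix m m ℝ) (g : Fin n → ℝ) : Matrix m m ℝ := ∑ i, g i • B i

omit [Fintype m] [DecidableEq m] in
lemma lc_herm {B : Fin n → Matrix m m ℝ} (hB : ∀ i, (B i).IsHermitian) (g : Fin n → ℝ) : (lc B g).IsHermitian := by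
  ext a b
  simp only [lc, conjTranspose_apply, Matrix.sum_apply, Matrix.smul_apply, star_trivial]
  exact Finset.sum_congr rfl fun i _ => by rw [← (hB i).apply a b]; simp

omit [Fintype m] [DecidableEq m] in
lemma lc_good (B : Fin n → Matrix m m ℝ) (a b : m) : Good (gam n) fun g => lc B g a b := by
  simp only [lc, Matrix.sum_apply, Matrix.smul_apply, smul_eq_mul]
  exact Good.sum _ fun i _ => (gam_good i).mul (Good.const _)

omit [Fintype m] [DecidableEq m] in
lemma lc_comb (B : Fin n → Matrix m m ℝ) (c s : ℝ) (g g' : Fin n → ℝ) :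
    lc B (c • g + s • g') = c • lc B g + s • lc B g' := by
  simp [lc, add_smul, Finset.sum_add_distrib, Finset.smul_sum, smul_smul]

lemma int_fst (F : (Fin n → ℝ) → ℝ) :
    ∫ z, F z.1 ∂((gam n).prod (gam n)) = ∫ g, F g ∂(gam n) := by
  rw [integral_fun_fst]; simp

omit [DecidableEq m] in
lemma int_lin {W : (Fin n → ℝ) → Matrix m m ℝ} (hW : ∀ a b, Good (gam n) fun g => W g a b)
    (B : Fin n → Matrix m m ℝ) :
    ∫ z, trace (W z.1 * lc B z.2) ∂((gam n).prod (gam n)) = 0 := by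
  have h1 : ∀ z : (Fin n → ℝ) × (Fin n → ℝ),
      trace (W z.1 * lc B z.2) = ∑ i, trace (W z.1 * B i) * z.2 i := by
    intro z
    simp only [lc, Matrix.mul_sum, trace_sum, mul_smul, Matrix.mul_smul, trace_smul, smul_eq_mul, mul_comm]
  simp only [h1]
  have hg : ∀ i, Good (gam n) fun g => trace (W g * B i) := fun i =>
    Good.trace (Good.matmul hW fun a b => Good.const _)
  rw [integral_finsetSum _ fun i _ => ((good_fst (hg i)).mul (good_snd (gam_good i))).integrable]
  refine Finset.sum_eq_zero fun i _ => ?_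
  rw [integral_prod_mul (fun g => trace (W g * B i)) (fun g : Fin n → ℝ => g i), gam_int, mul_zero]

omit [DecidableEq m] in
lemma int_quad {W : (Fin n → ℝ) → Matrix m m ℝ} (hW : ∀ a b, Good (gam n) fun g => W g a b) (B : Fin n → Matrix m m ℝ) :
    ∫ z, trace (W z.1 * (lc B z.2 * lc B z.2)) ∂((gam n).prod (gam n)) =
      ∫ g, trace (W g * ∑ i, B i * B i) ∂(gam n) := by
  have h1 : ∀ z : (Fin n → ℝ) × (Fin n → ℝ),
      trace (W z.1 * (lc B z.2 * lc B z.2)) = ∑ i, ∑ j, trace (W z.1 * (B i * B j)) * (z.2 i * z.2 j) := by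
    intro z
    simp only [lc, Matrix.sum_mul, Matrix.mul_sum, trace_sum, Matrix.smul_mul, Matrix.mul_smul, trace_smul, smul_eq_mul]
    conv_rhs => rw [Finset.sum_comm]
    refine Finset.sum_congr rfl fun i _ => ?_
    try rw [Finset.mul_sum]
    refine Finset.sum_congr rfl fun j _ => ?_
    ring
  have hg : ∀ i j, Good (gam n) fun g => trace (W g * (B i * B j)) := fun i j =>
    Good.trace (Good.matmul hW fun a b => Good.const _)
  have hh : ∀ i j, Good ((gam n).prod (gam n)) fun z => trace (W z.1 * (B i * B j)) * (z.2 i * z.2 j) :=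
    fun i j => (good_fst (hg i j)).mul (good_snd ((gam_good i).mul (gam_good j)))
  simp only [h1]
  rw [integral_finsetSum _ fun i _ => (Good.sum _ fun j _ => hh i j).integrable]
  simp only [Matrix.mul_sum, trace_sum]
  rw [integral_finsetSum _ fun i _ => (hg i i).integrable]
  refine Finset.sum_congr rfl fun i _ => ?_
  rw [integral_finsetSum _ fun j _ => (hh i j).integrable]
  have h2 : ∀ j, ∫ z, trace (W z.1 * (B i * B j)) * (z.2 i * z.2 j) ∂((gam n).prod (gam n))
      = (∫ g, trace (W g * (B i * B j)) ∂(gam n)) * if i = j then 1 else 0 := by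
    intro j
    rw [integral_prod_mul (fun g => trace (W g * (B i * B j))) (fun g : Fin n → ℝ => g i * g j), gam_int_mul]
  simp [h2]

lemma khin_aux {t : ℝ} (ht : 2 ≤ t) {B : Fin n → Matrix m m ℝ} (hB : ∀ i, (B i).IsHermitian) (θ : ℝ)
    (hθ : Real.cos θ < 1) :
    2 * ∫ g, trace (cfc (pf (2 * t)) (lc B g)) ∂(gam n) ≤
      (2 * t - 1) * ((1 - Real.cos θ) * (∫ g, trace (cfc (pf (2 * t)) (lc B g)) ∂(gam n))
        + (1 + Real.cos θ) * ∫ g, trace (cfc (pf (2 * t - 2)) (lc B g) * ∑ i, B i * B i) ∂(gam n)) := by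
  set r := 2 * t - 2 with hr
  have hr2 : 2 ≤ r := by linarith
  have hr0 : 0 ≤ r := by linarith
  set c := Real.cos θ
  set s := Real.sin θ
  have hcs : s ^ 2 = (1 - c) * (1 + c) := by have := Real.sin_sq_add_cos_sq θ; linear_combination this
  set E := ∫ g, trace (cfc (pf (2 * t)) (lc B g)) ∂(gam n) with hE
  set Q := ∫ g, trace (cfc (pf r) (lc B g) * ∑ i, B i * B i) ∂(gam n)
  have hH := lc_herm hB
  have gl : ∀ a b, Good (gam n) fun g => lc B g a b := lc_good B
  have gh : ∀ a b, Good (gam n) fun g => cfc (hf r) (lc B g) a b := Good.mf_hf hr0 hH gl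
  have gp : ∀ a b, Good (gam n) fun g => cfc (pf r) (lc B g) a b := Good.mf_pf hr0 hH gl
  -- X and Y on the product
  let X : (Fin n → ℝ) × (Fin n → ℝ) → Matrix m m ℝ := fun z => lc B z.1
  let Y : (Fin n → ℝ) × (Fin n → ℝ) → Matrix m m ℝ := fun z => lc B (c • z.1 + s • z.2)
  set ν := (gam n).prod (gam n)
  have hYe : ∀ z, Y z = c • lc B z.1 + s • lc B z.2 := fun z => lc_comb B c s z.1 z.2
  have gX : ∀ a b, Good ν fun z => X z a b := fun a b => good_fst (gl a b)
  have mpY : MeasurePreserving (fun z : (Fin n → ℝ) × (Fin n → ℝ) => c • z.1 + s • z.2) ν (gam n) :=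
    measurePreserving_fst.comp (gam_refl θ)
  have gY : ∀ a b, Good ν fun z => Y z a b := fun a b => (gl a b).comp mpY
  have ghX : ∀ a b, Good ν fun z => cfc (hf r) (X z) a b := fun a b => good_fst (gh a b)
  have ghY : ∀ a b, Good ν fun z => cfc (hf r) (Y z) a b := fun a b => (gh a b).comp mpY
  have gpX : ∀ a b, Good ν fun z => cfc (pf r) (X z) a b := fun a b => good_fst (gp a b)
  have gpY : ∀ a b, Good ν fun z => cfc (pf r) (Y z) a b := fun a b => (gp a b).comp mpY
  have gD : ∀ a b, Good ν fun z => ((X z - Y z) * (X z - Y z)) a b :=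
    Good.matmul (fun a b => (gX a b).sub (gY a b)) (fun a b => (gX a b).sub (gY a b))
  have sym : ∀ F : Matrix m m ℝ → Matrix m m ℝ → ℝ, (Good ν fun z => F (X z) (Y z)) →
      ∫ z, F (X z) (Y z) ∂ν = ∫ z, F (Y z) (X z) ∂ν := by
    intro F hF
    have h1 := (gam_refl (n := n) θ).map_eq
    have h2 : ∫ z, F (X z) (Y z) ∂ν = ∫ z, F (X z) (Y z) ∂(ν.map (fun z : (Fin n → ℝ) × (Fin n → ℝ) =>
      (Real.cos θ • z.1 + Real.sin θ • z.2, Real.sin θ • z.1 - Real.cos θ • z.2))) := by rw [h1]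
    rw [h2, integral_map (gam_refl θ).measurable.aemeasurable (hF.1.aestronglyMeasurable)]
    refine integral_congr_ae (Filter.Eventually.of_forall fun z => ?_)
    have e : c • (c • z.1 + s • z.2) + s • (s • z.1 - c • z.2) = z.1 := by
      have : c ^ 2 + s ^ 2 = 1 := by linear_combination hcs
      ext i; simp; linear_combination z.1 i * this
    simp only [X, Y]
    rw [show Real.cos θ = c from rfl, show Real.sin θ = s from rfl, e]
  have t1 := Good.trace (Good.matmul ghX gX)
  have t2 := Good.trace (Good.matmul ghX gY)
  have t3 := Good.trace (Good.matmul ghY gX)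
  have t4 := Good.trace (Good.matmul ghY gY)
  have t5 := Good.trace (Good.matmul gpX gD)
  have t6 := Good.trace (Good.matmul gpY gD)
  have s1 : ∫ z, trace (cfc (hf r) (Y z) * Y z) ∂ν = ∫ z, trace (cfc (hf r) (X z) * X z) ∂ν :=
    (sym (fun x y => trace (cfc (hf r) x * x)) t1).symm
  have s2 : ∫ z, trace (cfc (hf r) (Y z) * X z) ∂ν = ∫ z, trace (cfc (hf r) (X z) * Y z) ∂ν :=
    (sym (fun x y => trace (cfc (hf r) x * y)) t2).symm
  have s3 : ∫ z, trace (cfc (pf r) (Y z) * ((X z - Y z) * (X z - Y z))) ∂ν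
      = ∫ z, trace (cfc (pf r) (X z) * ((X z - Y z) * (X z - Y z))) ∂ν := by
    rw [sym (fun x y => trace (cfc (pf r) x * ((x - y) * (x - y)))) t5]
    refine integral_congr_ae (Filter.Eventually.of_forall fun z => ?_)
    simp only
    rw [← neg_sub (X z) (Y z), neg_mul_neg]
  have main := integral_mono (μ := ν) (((t1.sub t2).sub t3).add t4).integrable
    ((Good.const ((r + 1) / 2)).mul (t5.add t6)).integrable
    (fun z => tr_mvt hr2 (hH z.1) (hH (c • z.1 + s • z.2)))
  rw [integral_add ((t1.sub t2).sub t3).integrable t4.integrable,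
    integral_sub (t1.sub t2).integrable t3.integrable, integral_sub t1.integrable t2.integrable,
    integral_const_mul, integral_add t5.integrable t6.integrable, s1, s2, s3] at main
  -- evaluate
  have hxE : ∀ g, trace (cfc (hf r) (lc B g) * lc B g) = trace (cfc (pf (2 * t)) (lc B g)) := by
    intro g
    nth_rw 2 [← mf_id (hH g)]
    rw [mf_mul]
    congr 2
    funext x
    exact sc_abs_mul (by linarith) x
  have hxE' : ∀ g, trace (cfc (pf r) (lc B g) * (lc B g * lc B g)) = trace (cfc (pf (2 * t)) (lc B g)) := by
    intro g
    have xx : lc B g * lc B g = cfc (fun x : ℝ => x * x) (lc B g) := by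
      rw [← mf_mul (fun x => x) (fun x => x), mf_id (hH g)]
    rw [xx, mf_mul]
    congr 2
    funext x
    rw [← mul_assoc]
    exact sc_abs_mul (by linarith) x
  have v1 : ∫ z, trace (cfc (hf r) (X z) * X z) ∂ν = E := by
    simp only [X]
    rw [int_fst (fun g => trace (cfc (hf r) (lc B g) * lc B g))]
    simp only [hxE, hE]
  have v2 : ∫ z, trace (cfc (hf r) (X z) * Y z) ∂ν = c * E := by
    have e : ∀ z, trace (cfc (hf r) (X z) * Y z) =
        c * trace (cfc (hf r) (X z) * X z) + s * trace (cfc (hf r) (lc B z.1) * lc B z.2) := by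
      intro z
      rw [hYe, mul_add, trace_add, mul_smul_comm, mul_smul_comm, trace_smul, trace_smul]; rfl
    have q2 := Good.trace (Good.matmul ghX (fun a b => good_snd (gl a b)))
    simp only [e]
    rw [integral_add ((Good.const c).mul t1).integrable ((Good.const s).mul q2).integrable,
      integral_const_mul, integral_const_mul, v1, int_lin gh]; ring
  have v5 : ∫ z, trace (cfc (pf r) (X z) * ((X z - Y z) * (X z - Y z))) ∂ν = (1 - c) ^ 2 * E + s ^ 2 * Q := by
    have e : ∀ z, trace (cfc (pf r) (X z) * ((X z - Y z) * (X z - Y z))) =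
        (1 - c) ^ 2 * trace (cfc (pf r) (lc B z.1) * (lc B z.1 * lc B z.1))
        - (1 - c) * s * (trace ((cfc (pf r) (lc B z.1) * lc B z.1) * lc B z.2)
          + trace ((lc B z.1 * cfc (pf r) (lc B z.1)) * lc B z.2))
        + s ^ 2 * trace (cfc (pf r) (lc B z.1) * (lc B z.2 * lc B z.2)) := by
      intro z
      have d : X z - Y z = (1 - c) • lc B z.1 - s • lc B z.2 := by
        rw [hYe]; simp only [X]; module
      have k1 : trace (cfc (pf r) (lc B z.1) * (lc B z.2 * lc B z.1)) =
          trace ((lc B z.1 * cfc (pf r) (lc B z.1)) * lc B z.2) := by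
        rw [← mul_assoc, trace_mul_comm, mul_assoc]
      rw [d, ← k1]
      simp only [sub_mul, mul_sub, smul_mul_assoc, mul_smul_comm, trace_sub, trace_smul, smul_eq_mul, mul_assoc, X]
      ring
    have gx1 : ∀ a b, Good (gam n) fun g => (cfc (pf r) (lc B g) * lc B g) a b := Good.matmul gp gl
    have gx2 : ∀ a b, Good (gam n) fun g => (lc B g * cfc (pf r) (lc B g)) a b := Good.matmul gl gp
    have q1 := Good.trace (fun a b => good_fst (Good.matmul gp (Good.matmul gl gl) a b))
    have q2 := Good.trace (Good.matmul (fun a b => good_fst (gx1 a b)) (fun a b => good_snd (gl a b)))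
    have q3 := Good.trace (Good.matmul (fun a b => good_fst (gx2 a b)) (fun a b => good_snd (gl a b)))
    have q4 := Good.trace (Good.matmul gpX (fun a b => good_snd (Good.matmul gl gl a b)))
    simp only [e]
    rw [integral_add (((Good.const _).mul q1).sub ((Good.const _).mul (q2.add q3))).integrable
        ((Good.const _).mul q4).integrable,
      integral_sub ((Good.const _).mul q1).integrable ((Good.const _).mul (q2.add q3)).integrable,
      integral_const_mul, integral_const_mul, integral_const_mul, integral_add q2.integrable q3.integrable,
      int_lin gx1, int_lin gx2, int_quad gp,
      int_fst (fun g => trace (cfc (pf r) (lc B g) * (lc B g * lc B g)))]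
    simp only [hxE', ← hE]; ring
  rw [v1, v2, v5, hcs] at main
  have hc : 0 < 1 - c := by linarith
  have : (1 - c) * (2 * E) ≤ (1 - c) * ((2 * t - 1) * ((1 - c) * E + (1 + c) * Q)) := by
    rw [hr] at main
    nlinarith
  exact le_of_mul_le_mul_left this hc

lemma khin {t : ℝ} (ht : 2 ≤ t) {B : Fin n → Matrix m m ℝ} (hB : ∀ i, (B i).IsHermitian) :
    ∫ g, trace (cfc (pf (2 * t)) (lc B g)) ∂(gam n) ≤
      (2 * t - 1) ^ t * trace (cfc (fun x : ℝ => x ^ t) (∑ i, B i * B i)) := by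
  set E := ∫ g, trace (cfc (pf (2 * t)) (lc B g)) ∂(gam n) with hE
  set Q := ∫ g, trace (cfc (pf (2 * t - 2)) (lc B g) * ∑ i, B i * B i) ∂(gam n) with hQ
  have h1 : 2 * E ≤ (2 * t - 1) * ((1 - 1) * E + (1 + 1) * Q) := by
    have hl : Filter.Tendsto (fun θ => (2 * t - 1) * ((1 - Real.cos θ) * E + (1 + Real.cos θ) * Q))
        (nhdsWithin 0 (Set.Ioi 0)) (nhds ((2 * t - 1) * ((1 - 1) * E + (1 + 1) * Q))) := by
      have : Continuous (fun θ => (2 * t - 1) * ((1 - Real.cos θ) * E + (1 + Real.cos θ) * Q)) := by fun_prop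
      have h := this.tendsto 0
      rw [Real.cos_zero] at h
      exact h.mono_left nhdsWithin_le_nhds
    refine ge_of_tendsto hl ?_
    filter_upwards [Ioo_mem_nhdsGT Real.pi_pos] with θ hθ
    refine khin_aux ht hB θ ?_
    have := Real.cos_lt_cos_of_nonneg_of_le_pi le_rfl hθ.2.le hθ.1
    rwa [Real.cos_zero] at this
  have hH := lc_herm hB
  have gl : ∀ a b, Good (gam n) fun g => lc B g a b := lc_good B
  have gp := Good.trace (Good.mf_pf (r := 2 * t) (by linarith) hH gl)
  have gq := Good.trace (Good.matmul (Good.mf_pf (r := 2 * t - 2) (by linarith) hH gl)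
    (fun a b => Good.const ((∑ i, B i * B i) a b)))
  have hG : (∑ i, B i * B i).PosSemidef := by
    refine Matrix.posSemidef_sum _ fun i _ => ?_
    have := Matrix.posSemidef_conjTranspose_mul_self (B i)
    rwa [(hB i).eq] at this
  have h2 := integral_mono (μ := gam n)
    ((Good.const t).mul ((Good.const (2 * t - 1)).mul gq)).integrable
    (((Good.const (t - 1)).mul gp).add
      (Good.const ((2 * t - 1) ^ t * trace (cfc (fun x : ℝ => x ^ t) (∑ i, B i * B i))))).integrable
    (fun g => tr_young (c := 2 * t - 1) (by linarith) (hH g) hG (by linarith))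
  rw [integral_add ((Good.const (t - 1)).mul gp).integrable (Good.const _).integrable,
    integral_const_mul, integral_const_mul, integral_const_mul] at h2
  simp only [integral_const, probReal_univ, one_smul] at h2
  change t * ((2 * t - 1) * Q) ≤ (t - 1) * E + _ at h2
  nlinarith

end Gauss


section MP
variable {n : ℕ}

lemma poly_good (p : MvPolynomial (Fin n) ℝ) : Good (gam n) fun x => MvPolynomial.eval x p := by
  induction p using MvPolynomial.induction_on with
  | C a => simpa using Good.const a
  | add p q hp hq => simpa using hp.add hq
  | mul_X p i hp => simpa using hp.mul (gam_good i)

lemma poly_curve (p : MvPolynomial (Fin n) ℝ) (γ : ℝ → Fin n → ℝ) (γ' : Fin n → ℝ) (u : ℝ)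
    (h : ∀ i, HasDerivAt (fun s => γ s i) (γ' i) u) :
    HasDerivAt (fun s => MvPolynomial.eval (γ s) p)
      (∑ i, γ' i * MvPolynomial.eval (γ u) (MvPolynomial.pderiv i p)) u := by
  induction p using MvPolynomial.induction_on with
  | C a => simpa using hasDerivAt_const u a
  | add p q hp hq =>
    have := hp.add hq
    simp only [map_add, mul_add, Finset.sum_add_distrib]
    exact this
  | mul_X p i hp =>
    have := hp.mul (h i)
    simp only [map_mul, MvPolynomial.eval_X, Derivation.leibniz, MvPolynomial.pderiv_X, smul_eq_mul, map_add]
    refine this.congr_deriv ?_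
    simp only [mul_add, Finset.sum_add_distrib, Finset.sum_mul]
    rw [add_comm]
    congr 1
    · rw [Finset.sum_eq_single i]
      · simp; ring
      · intro j _ hj; simp [hj.symm]
      · simp
    · exact Finset.sum_congr rfl fun j _ => by ring

variable {R C : Type*} [Fintype R] [Fintype C] [DecidableEq R] [DecidableEq C]

lemma khin_rect {t : ℝ} (ht : 2 ≤ t) (A : Fin n → Matrix R C ℝ)
    {R' C'' : Type*} [Fintype R'] [Fintype C''] [DecidableEq C'']
    (V : Matrix R' C ℝ) (W : Matrix R C'' ℝ)
    (hV : Vᵀ * V = ∑ i, (A i)ᵀ * A i) (hW : W * Wᵀ = ∑ i, A i * (A i)ᵀ) :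
    ∫ g : Fin n → ℝ, schattenPow t (∑ i, g i • A i) ∂(gam n) ≤
      (2 * t - 1) ^ t / 2 * (schattenPow t V + schattenPow t W) := by
  have h := khin ht (B := fun i => dil (A i)) fun i => dil_herm (A i)
  have h1 : ∀ g : Fin n → ℝ, lc (fun i => dil (A i)) g = dil (∑ i, g i • A i) := by
    intro g
    ext a b
    rcases a with a | a <;> rcases b with b | b <;>
      simp [lc, dil, Matrix.sum_apply]
  have h2 : ∑ i, dil (A i) * dil (A i) = fromBlocks (W * Wᵀ) 0 0 (Vᵀ * V) := by
    rw [hV, hW]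
    simp only [dil_sq]
    ext a b
    rcases a with a | a <;> rcases b with b | b <;>
      simp [Matrix.sum_apply]
  have ht0 : 0 < t := by linarith
  simp only [h1, h2, psi_dil ht0] at h
  rw [trace_mf_blocks (herm_mult W) (herm_tmul V), ← sp_eq, ← sp_eq' ht0, integral_const_mul] at h
  linarith

lemma jensen {X Y : Type*} [MeasurableSpace X] [MeasurableSpace Y] (μ : Measure X) (κ : Measure Y)
    [IsProbabilityMeasure μ] [IsProbabilityMeasure κ] {t : ℝ} (ht : 1 ≤ t)
    (H : X × Y → Matrix R C ℝ) (hH : ∀ r c, Good (μ.prod κ) fun z => H z r c)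
    (M : X → Matrix R C ℝ) (hM : ∀ r c, ∀ᵐ x ∂μ, M x r c = ∫ y, H (x, y) r c ∂κ) :
    ∫ x, schattenPow t (M x) ∂μ ≤ ∫ z, schattenPow t (H z) ∂(μ.prod κ) := by
  have hS : Good (μ.prod κ) fun z => schattenPow t (H z) := Good.sp (by linarith) hH
  rw [integral_prod _ hS.integrable]
  refine integral_mono_of_nonneg (Filter.Eventually.of_forall fun x => sp_nonneg _ _)
    hS.integrable.integral_prod_left ?_
  have h1 : ∀ᵐ x ∂μ, ∀ r c, M x r c = ∫ y, H (x, y) r c ∂κ := by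
    rw [ae_all_iff]; intro r; rw [ae_all_iff]; exact hM r
  have h2 : ∀ᵐ x ∂μ, ∀ r c, Integrable (fun y => H (x, y) r c) κ := by
    rw [ae_all_iff]; intro r; rw [ae_all_iff]; intro c
    exact (hH r c).integrable.prod_right_ae
  filter_upwards [h1, h2, hS.integrable.prod_right_ae] with x h1 h2 h3
  obtain ⟨G, hG⟩ := sp_subgrad ht (M x)
  have h6 : ∀ r c, Integrable (fun y => G r c * (H (x, y) r c - M x r c)) κ := fun r c =>
      ((h2 r c).sub (integrable_const _)).const_mul _
  have hi : Integrable (fun y => ∑ r, ∑ c, G r c * (H (x, y) r c - M x r c)) κ :=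
    integrable_finsetSum _ fun r _ => integrable_finsetSum _ fun c _ => h6 r c
  have h4 : ∫ y, (schattenPow t (M x) + ∑ r, ∑ c, G r c * (H (x, y) r c - M x r c)) ∂κ
      ≤ ∫ y, schattenPow t (H (x, y)) ∂κ :=
    integral_mono ((integrable_const _).add hi) h3 fun y => hG _
  rw [integral_add (integrable_const _) hi] at h4
  have h5 : ∫ y, (∑ r, ∑ c, G r c * (H (x, y) r c - M x r c)) ∂κ = 0 := by
    rw [integral_finsetSum _ fun r _ => integrable_finsetSum _ fun c _ => h6 r c]
    refine Finset.sum_eq_zero fun r _ => ?_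
    rw [integral_finsetSum _ fun c _ => h6 r c]
    refine Finset.sum_eq_zero fun c _ => ?_
    rw [integral_const_mul, integral_sub (h2 r c) (integrable_const _), h1 r c]
    simp
  simpa [h5] using h4

/-- uniform measure on the unit interval -/
noncomputable abbrev lam : Measure ℝ := volume.restrict (Set.Ioc 0 1)

instance lam_prob : IsProbabilityMeasure lam := ⟨by simp [lam]⟩

/-- the rotation -/
noncomputable def rt (u : ℝ) (z : (Fin n → ℝ) × (Fin n → ℝ)) : (Fin n → ℝ) × (Fin n → ℝ) :=
  (Real.cos (Real.pi / 2 * u) • z.1 + Real.sin (Real.pi / 2 * u) • z.2,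
    -Real.sin (Real.pi / 2 * u) • z.1 + Real.cos (Real.pi / 2 * u) • z.2)

lemma rt_mp : MeasurePreserving (fun w : (Fin n → ℝ) × (ℝ × (Fin n → ℝ)) => rt w.2.1 (w.2.2, w.1))
    ((gam n).prod (lam.prod (gam n))) ((gam n).prod (gam n)) := by
  have h1 : MeasurePreserving (fun w : ℝ × ((Fin n → ℝ) × (Fin n → ℝ)) => (w.1, rt w.1 w.2))
      (lam.prod ((gam n).prod (gam n))) (lam.prod ((gam n).prod (gam n))) := by
    refine (MeasurePreserving.id lam).skew_product (g := rt) ?_ ?_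
    · unfold rt Function.uncurry
      fun_prop
    · exact Filter.Eventually.of_forall fun u => (gam_rot (Real.pi / 2 * u)).map_eq
  have h2 : MeasurePreserving (Prod.snd : ℝ × ((Fin n → ℝ) × (Fin n → ℝ)) → _)
      (lam.prod ((gam n).prod (gam n))) ((gam n).prod (gam n)) := measurePreserving_snd
  have h3 := measurePreserving_prodAssoc lam (gam n) (gam n)
  have h4 : MeasurePreserving Prod.swap ((gam n).prod (lam.prod (gam n))) ((lam.prod (gam n)).prod (gam n)) :=
    Measure.measurePreserving_swap
  have h5 := h3.comp h4
  have h6 := h2.comp h1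
  have h7 := h6.comp h5
  have e : (fun w : (Fin n → ℝ) × (ℝ × (Fin n → ℝ)) => rt w.2.1 (w.2.2, w.1)) =
      ((Prod.snd ∘ fun w : ℝ × ((Fin n → ℝ) × (Fin n → ℝ)) => (w.1, rt w.1 w.2)) ∘
        (MeasurableEquiv.prodAssoc ∘ Prod.swap)) := by
    funext w; rfl
  rw [e]
  exact h7

/-- linearized increment -/
noncomputable def lin (p : R → C → MvPolynomial (Fin n) ℝ) (z : (Fin n → ℝ) × (Fin n → ℝ)) : Matrix R C ℝ :=
  ∑ i, z.2 i • (Matrix.of fun r c => MvPolynomial.eval z.1 (MvPolynomial.pderiv i (p r c)) : Matrix R C ℝ)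

omit [Fintype R] [Fintype C] [DecidableEq R] [DecidableEq C] in
lemma lin_apply (p : R → C → MvPolynomial (Fin n) ℝ) (z : (Fin n → ℝ) × (Fin n → ℝ)) (r : R) (c : C) :
    lin p z r c = ∑ i, z.2 i * MvPolynomial.eval z.1 (MvPolynomial.pderiv i (p r c)) := by
  simp [lin, Matrix.sum_apply]

omit [Fintype R] [Fintype C] [DecidableEq R] [DecidableEq C] in
lemma lin_good (p : R → C → MvPolynomial (Fin n) ℝ) (r : R) (c : C) :
    Good ((gam n).prod (gam n)) fun z => lin p z r c := by
  simp only [lin_apply]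
  exact Good.sum _ fun i _ => (good_snd (gam_good i)).mul (good_fst (poly_good _))

omit [Fintype R] [Fintype C] [DecidableEq R] [DecidableEq C] in
lemma ftc (p : R → C → MvPolynomial (Fin n) ℝ) (z y : Fin n → ℝ) (r : R) (c : C) :
    ∫ u, Real.pi / 2 * lin p (rt u (z, y)) r c ∂lam =
      MvPolynomial.eval y (p r c) - MvPolynomial.eval z (p r c) := by
  have hd : ∀ u : ℝ, HasDerivAt (fun s => MvPolynomial.eval (rt s (z, y)).1 (p r c))
      (Real.pi / 2 * lin p (rt u (z, y)) r c) u := by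
    intro u
    refine (poly_curve (p r c) (fun s => (rt s (z, y)).1) (fun i => Real.pi / 2 * (rt u (z, y)).2 i) u
      fun i => ?_).congr_deriv ?_
    · have hl : HasDerivAt (fun s : ℝ => Real.pi / 2 * s) (Real.pi / 2) u := by
        simpa using (hasDerivAt_id u).const_mul (Real.pi / 2)
      have := (hl.cos.mul_const (z i)).add (hl.sin.mul_const (y i))
      simp only [rt, Pi.add_apply, Pi.smul_apply, smul_eq_mul, neg_smul, Pi.neg_apply]
      exact this.congr_deriv (by ring)
    · rw [lin_apply, Finset.mul_sum]
      exact Finset.sum_congr rfl fun i _ => by ring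
  have hc : Continuous fun u => Real.pi / 2 * lin p (rt u (z, y)) r c := by
    simp only [lin_apply, rt]
    refine continuous_const.mul (continuous_finsetSum _ fun i _ => ?_)
    refine Continuous.mul (by fun_prop) ((MvPolynomial.continuous_eval _).comp (by fun_prop))
  have h := intervalIntegral.integral_eq_sub_of_hasDerivAt (a := 0) (b := 1) (fun u _ => hd u)
    (hc.intervalIntegrable _ _)
  rw [intervalIntegral.integral_of_le zero_le_one] at h
  rw [lam, h]
  simp [rt]

lemma maurey_pisier {t : ℝ} (ht : 1 ≤ t) (p : R → C → MvPolynomial (Fin n) ℝ) :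
    ∫ x, schattenPow t (Matrix.of fun r c => MvPolynomial.eval x (p r c)
        - ∫ y, MvPolynomial.eval y (p r c) ∂(gam n) : Matrix R C ℝ) ∂(gam n) ≤
      (Real.pi / 2) ^ (2 * t) * ∫ z, schattenPow t (lin p z) ∂((gam n).prod (gam n)) := by
  have hg : ∀ r c, Good ((gam n).prod (lam.prod (gam n)))
      fun w => Real.pi / 2 * lin p (rt w.2.1 (w.2.2, w.1)) r c :=
    fun r c => (Good.const _).mul ((lin_good p r c).comp rt_mp)
  have h := jensen (gam n) (lam.prod (gam n)) ht
    (fun w => (Real.pi / 2) • lin p (rt w.2.1 (w.2.2, w.1))) hg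
    (fun x => Matrix.of fun r c => MvPolynomial.eval x (p r c)
        - ∫ y, MvPolynomial.eval y (p r c) ∂(gam n)) ?_
  · refine h.trans (le_of_eq ?_)
    simp only [sp_smul t (show 0 ≤ Real.pi / 2 by positivity)]
    rw [integral_const_mul]
    congr 1
    have hm : Measurable fun z => schattenPow t (lin p z) := (Good.sp (ν := (gam n).prod (gam n)) (by linarith : 0 ≤ t) (lin_good p)).1
    rw [← rt_mp.map_eq, integral_map rt_mp.measurable.aemeasurable hm.aestronglyMeasurable]
  · intro r c
    filter_upwards [(hg r c).integrable.prod_right_ae] with y hy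
    simp only [Matrix.smul_apply, smul_eq_mul, Matrix.of_apply]
    rw [integral_prod_symm _ hy]
    simp only [ftc]
    rw [integral_sub (integrable_const _) (poly_good _).integrable]
    simp

lemma mp_main {t : ℝ} (ht : 2 ≤ t) (p : R → C → MvPolynomial (Fin n) ℝ)
    {R' C'' : Type*} [Fintype R'] [Fintype C''] [DecidableEq C'']
    (V : (Fin n → ℝ) → Matrix R' C ℝ) (W : (Fin n → ℝ) → Matrix R C'' ℝ)
    (hVg : ∀ r c, Good (gam n) fun x => V x r c) (hWg : ∀ r c, Good (gam n) fun x => W x r c)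
    (hV : ∀ x, (V x)ᵀ * V x = ∑ i, (Matrix.of fun r c => MvPolynomial.eval x (MvPolynomial.pderiv i (p r c)) : Matrix R C ℝ)ᵀ
      * (Matrix.of fun r c => MvPolynomial.eval x (MvPolynomial.pderiv i (p r c)) : Matrix R C ℝ))
    (hW : ∀ x, W x * (W x)ᵀ = ∑ i, (Matrix.of fun r c => MvPolynomial.eval x (MvPolynomial.pderiv i (p r c)) : Matrix R C ℝ)
      * (Matrix.of fun r c => MvPolynomial.eval x (MvPolynomial.pderiv i (p r c)) : Matrix R C ℝ)ᵀ) :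
    ∫ x, schattenPow t (Matrix.of fun r c => MvPolynomial.eval x (p r c)
        - ∫ y, MvPolynomial.eval y (p r c) ∂(gam n) : Matrix R C ℝ) ∂(gam n) ≤
      (Real.pi / 2) ^ (2 * t) * ((2 * t - 1) ^ t / 2 *
        ((∫ x, schattenPow t (V x) ∂(gam n)) + ∫ x, schattenPow t (W x) ∂(gam n))) := by
  have hVs : Good (gam n) fun x => schattenPow t (V x) := Good.sp (by linarith) hVg
  have hWs : Good (gam n) fun x => schattenPow t (W x) := Good.sp (by linarith) hWg
  have hL : Good ((gam n).prod (gam n)) fun z => schattenPow t (lin p z) := Good.sp (by linarith) (lin_good p)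
  refine (maurey_pisier (by linarith) p).trans (mul_le_mul_of_nonneg_left ?_ (by positivity))
  rw [integral_prod _ hL.integrable, ← integral_add hVs.integrable hWs.integrable, ← integral_const_mul]
  refine integral_mono hL.integrable.integral_prod_left ((hVs.integrable.add hWs.integrable).const_mul _) fun x => ?_
  have := khin_rect ht _ (V x) (W x) (hV x) (hW x)
  simp only [lin]
  exact this

end MP


section Fin6
variable {n : ℕ}

lemma poly_diff (p : MvPolynomial (Fin n) ℝ) : Differentiable ℝ fun x : Fin n → ℝ => MvPolynomial.eval x p := by
  induction p using MvPolynomial.induction_on with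
  | C a => simp
  | add p q hp hq => simp only [map_add]; exact hp.add hq
  | mul_X p i hp =>
    simp only [map_mul, MvPolynomial.eval_X]
    exact hp.mul (by fun_prop)

lemma poly_fderiv (p : MvPolynomial (Fin n) ℝ) (x : Fin n → ℝ) (v : Fin n) :
    fderiv ℝ (fun y : Fin n → ℝ => MvPolynomial.eval y p) x (Pi.single v 1) =
      MvPolynomial.eval x (MvPolynomial.pderiv v p) := by
  have h1 := ((poly_diff p) x).hasFDerivAt.hasLineDerivAt (Pi.single v 1)
  have h2 := poly_curve p (fun s => x + s • Pi.single v 1) (Pi.single v 1) 0 (fun i => by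
    have := ((hasDerivAt_id (0 : ℝ)).mul_const ((Pi.single v 1 : Fin n → ℝ) i)).const_add (x i)
    simpa using this)
  have h3 := HasDerivAt.unique h1 h2
  rw [h3]
  simp [Pi.single_apply]

lemma pd_comm (i j : Fin n) (p : MvPolynomial (Fin n) ℝ) :
    MvPolynomial.pderiv i (MvPolynomial.pderiv j p) = MvPolynomial.pderiv j (MvPolynomial.pderiv i p) := by
  induction p using MvPolynomial.induction_on with
  | C a => simp
  | add p q hp hq => simp [hp, hq]
  | mul_X p k hp =>
    simp only [Derivation.leibniz, MvPolynomial.pderiv_X, smul_eq_mul, map_add, hp]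
    have h : ∀ (i j k : Fin n), MvPolynomial.pderiv i (Pi.single (M := fun _ => MvPolynomial (Fin n) ℝ) j 1 k) = 0 := by
      intro i j k
      by_cases hjk : k = j
      · subst hjk; simp
      · simp [hjk]
    rw [h, h]; ring

/-- iterated polynomial derivative -/
noncomputable def dp (l : List (Fin n)) (p : MvPolynomial (Fin n) ℝ) : MvPolynomial (Fin n) ℝ :=
  l.foldl (fun p i => MvPolynomial.pderiv i p) p

lemma dp_pd (l : List (Fin n)) (i : Fin n) (p : MvPolynomial (Fin n) ℝ) :
    dp l (MvPolynomial.pderiv i p) = MvPolynomial.pderiv i (dp l p) := by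
  induction l generalizing p with
  | nil => simp only [dp, List.foldl_nil]
  | cons j l ih =>
    simp only [dp, List.foldl_cons] at ih ⊢
    rw [pd_comm, ih]

lemma dp_cons (l : List (Fin n)) (i : Fin n) (p : MvPolynomial (Fin n) ℝ) :
    dp (i :: l) p = MvPolynomial.pderiv i (dp l p) := by
  rw [← dp_pd]; simp only [dp, List.foldl_cons]

lemma dp_append (l l' : List (Fin n)) (p : MvPolynomial (Fin n) ℝ) : dp (l ++ l') p = dp l' (dp l p) := by
  simp only [dp, List.foldl_append]

lemma dp_mid (l l' : List (Fin n)) (i : Fin n) (p : MvPolynomial (Fin n) ℝ) :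
    dp (l ++ i :: l') p = MvPolynomial.pderiv i (dp (l ++ l') p) := by
  rw [dp_append, dp_cons, dp_append]

variable {R C : Type*}

lemma iter_poly (P : (Fin n → ℝ) → Matrix R C ℝ) (p : R → C → MvPolynomial (Fin n) ℝ)
    (hP : ∀ x r c, P x r c = MvPolynomial.eval x (p r c)) {k : ℕ} (w : Fin k → Fin n) :
    ∀ x r c, iterPDeriv P w x r c = MvPolynomial.eval x (dp (List.ofFn w) (p r c)) := by
  induction k with
  | zero => intro x r c; simp [iterPDeriv, hP, dp]
  | succ k ih =>
    intro x r c
    rw [iterPDeriv, pderivAt, Matrix.of_apply]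
    simp only [ih]
    rw [poly_fderiv, List.ofFn_succ', List.concat_eq_append, dp_append]
    simp only [dp, List.foldl_cons, List.foldl_nil]

lemma blocks_poly (P : (Fin n → ℝ) → Matrix R C ℝ) (p : R → C → MvPolynomial (Fin n) ℝ)
    (hP : ∀ x r c, P x r c = MvPolynomial.eval x (p r c)) (a b : ℕ) (x : Fin n → ℝ)
    (r : (Fin a → Fin n) × R) (c : (Fin b → Fin n) × C) :
    derivBlocks2 P a b x r c = MvPolynomial.eval x (dp (List.ofFn r.1 ++ List.ofFn c.1) (p r.2 c.2)) := by
  rw [derivBlocks2, Matrix.of_apply, iter_poly P p hP, List.ofFn_fin_append]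

lemma const_bound {t : ℝ} (ht : 2 ≤ t) :
    (Real.pi / 2) ^ (2 * t) * ((2 * t - 1) ^ t / 2 * (2 ^ (2 * t) / 2)) ≤ (2 * Real.sqrt 2 * t) ^ (2 * t) := by
  have hpi : Real.pi ^ 2 ≤ 10 := by nlinarith [Real.pi_lt_d2, Real.pi_pos]
  have e1 : (Real.pi / 2) ^ (2 * t) = (Real.pi ^ 2 / 4) ^ t := by
    rw [Real.rpow_mul (by positivity)]; norm_num [div_pow]
  have e2 : (2 : ℝ) ^ (2 * t) = 4 ^ t := by
    rw [Real.rpow_mul (by positivity)]; norm_num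
  have e3 : (2 * Real.sqrt 2 * t) ^ (2 * t) = (8 * t ^ 2) ^ t := by
    rw [Real.rpow_mul (by positivity)]
    congr 1
    rw [Real.rpow_two, mul_pow, mul_pow, Real.sq_sqrt (by norm_num)]; ring
  rw [e1, e2, e3]
  have h1 : (Real.pi ^ 2 / 4) ^ t * ((2 * t - 1) ^ t * 4 ^ t) ≤ (8 * t ^ 2) ^ t := by
    rw [← Real.mul_rpow (by linarith) (by norm_num), ← Real.mul_rpow (by positivity) (by nlinarith)]
    refine Real.rpow_le_rpow (mul_nonneg (by positivity) (by nlinarith)) ?_ (by linarith)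
    nlinarith [mul_nonneg (sub_nonneg.2 hpi) (by linarith : 0 ≤ 2 * t - 1), sq_nonneg (t - 2)]
  have h2 : 0 ≤ (Real.pi ^ 2 / 4) ^ t * ((2 * t - 1) ^ t * 4 ^ t) := by
    have : 0 ≤ 2 * t - 1 := by linarith
    positivity
  linarith

variable [Fintype R] [Fintype C] [DecidableEq R] [DecidableEq C]

omit [DecidableEq R] in
lemma split_mean {t : ℝ} (ht : 2 ≤ t) (V : (Fin n → ℝ) → Matrix R C ℝ)
    (hV : ∀ r c, Good (gam n) fun x => V x r c) (M : Matrix R C ℝ) :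
    ∫ x, schattenPow t (V x) ∂(gam n) ≤
      2 ^ (2 * t) / 2 * ((∫ x, schattenPow t (V x - M) ∂(gam n)) + schattenPow t M) := by
  classical
  have h1 : Good (gam n) fun x => schattenPow t (V x) := Good.sp (by linarith) hV
  have h2 : Good (gam n) fun x => schattenPow t (V x - M) :=
    Good.sp (by linarith) fun r c => (hV r c).sub (Good.const _)
  have h3 : ∫ x, schattenPow t (V x) ∂(gam n) ≤
      ∫ x, 2 ^ (2 * t) / 2 * (schattenPow t (V x - M) + schattenPow t M) ∂(gam n) := by
    refine integral_mono h1.integrable (((h2.add (Good.const _)).integrable).const_mul _) fun x => ?_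
    have := sp_add_le (by linarith : 1 ≤ t) (V x - M) M
    simpa using this
  rw [integral_const_mul, integral_add h2.integrable (integrable_const _)] at h3
  simpa using h3

lemma final_step {t : ℝ} (ht : 2 ≤ t) (P : (Fin n → ℝ) → Matrix R C ℝ) (p : R → C → MvPolynomial (Fin n) ℝ)
    (hP : ∀ x r c, P x r c = MvPolynomial.eval x (p r c)) (a b : ℕ) :
    ∫ x, schattenPow t
        (derivBlocks2 P a b x - matIntegral (gam n) fun x => derivBlocks2 P a b x) ∂(gam n)
      ≤ (2 * Real.sqrt 2 * t) ^ (2 * t) *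
          ((∫ x, schattenPow t (derivBlocks2 P (a + 1) b x
              - matIntegral (gam n) fun x => derivBlocks2 P (a + 1) b x) ∂(gam n))
            + schattenPow t (matIntegral (gam n) fun x => derivBlocks2 P (a + 1) b x)
            + (∫ x, schattenPow t (derivBlocks2 P a (b + 1) x
                - matIntegral (gam n) fun x => derivBlocks2 P a (b + 1) x) ∂(gam n))
            + schattenPow t (matIntegral (gam n) fun x => derivBlocks2 P a (b + 1) x)) := by
  have hB := fun a b => blocks_poly P p hP a b
  have hg : ∀ a b r c, Good (gam n) fun x => derivBlocks2 P a b x r c := by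
    intro a b r c
    simp only [hB]
    exact poly_good _
  have h := mp_main ht (fun (r : (Fin a → Fin n) × R) (c : (Fin b → Fin n) × C) =>
      dp (List.ofFn r.1 ++ List.ofFn c.1) (p r.2 c.2))
    (fun x => derivBlocks2 P (a + 1) b x) (fun x => derivBlocks2 P a (b + 1) x) (hg _ _) (hg _ _)
    (fun x => by
      ext c c'
      simp only [Matrix.mul_apply, Matrix.sum_apply, Matrix.transpose_apply, Matrix.of_apply, hB]
      rw [Fintype.sum_prod_type, ← (Fin.consEquiv fun _ => Fin n).sum_comp, Fintype.sum_prod_type]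
      refine Finset.sum_congr rfl fun i _ => ?_
      rw [Fintype.sum_prod_type]
      refine Finset.sum_congr rfl fun w _ => Finset.sum_congr rfl fun r _ => ?_
      simp [Fin.consEquiv, List.ofFn_succ, dp_cons])
    (fun x => by
      ext c c'
      simp only [Matrix.mul_apply, Matrix.sum_apply, Matrix.transpose_apply, Matrix.of_apply, hB]
      rw [Fintype.sum_prod_type, ← (Fin.consEquiv fun _ => Fin n).sum_comp, Fintype.sum_prod_type]
      refine Finset.sum_congr rfl fun i _ => ?_
      rw [Fintype.sum_prod_type]
      refine Finset.sum_congr rfl fun w _ => Finset.sum_congr rfl fun r _ => ?_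
      simp [Fin.consEquiv, List.ofFn_succ, dp_mid])
  have e : ∀ x, derivBlocks2 P a b x - (matIntegral (gam n) fun x => derivBlocks2 P a b x) =
      Matrix.of fun r c => MvPolynomial.eval x (dp (List.ofFn r.1 ++ List.ofFn c.1) (p r.2 c.2))
        - ∫ y, MvPolynomial.eval y (dp (List.ofFn r.1 ++ List.ofFn c.1) (p r.2 c.2)) ∂(gam n) := by
    intro x
    ext r c
    simp only [Matrix.sub_apply, matIntegral, Matrix.of_apply, hB]
  simp only [e]
  refine h.trans ?_
  have s1 := split_mean ht (fun x => derivBlocks2 P (a + 1) b x) (hg _ _)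
    (matIntegral (gam n) fun x => derivBlocks2 P (a + 1) b x)
  have s2 := split_mean ht (fun x => derivBlocks2 P a (b + 1) x) (hg _ _)
    (matIntegral (gam n) fun x => derivBlocks2 P a (b + 1) x)
  have n1 : 0 ≤ ∫ x, schattenPow t (derivBlocks2 P (a + 1) b x
              - matIntegral (gam n) fun x => derivBlocks2 P (a + 1) b x) ∂(gam n) :=
    integral_nonneg fun x => sp_nonneg _ _
  have n2 : 0 ≤ ∫ x, schattenPow t (derivBlocks2 P a (b + 1) x
              - matIntegral (gam n) fun x => derivBlocks2 P a (b + 1) x) ∂(gam n) :=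
    integral_nonneg fun x => sp_nonneg _ _
  have n3 := sp_nonneg t (matIntegral (gam n) fun x => derivBlocks2 P (a + 1) b x)
  have n4 := sp_nonneg t (matIntegral (gam n) fun x => derivBlocks2 P a (b + 1) x)
  have hc := const_bound ht
  generalize (∫ x, schattenPow t (derivBlocks2 P (a + 1) b x
              - matIntegral (gam n) fun x => derivBlocks2 P (a + 1) b x) ∂(gam n)) = I1 at *
  generalize (∫ x, schattenPow t (derivBlocks2 P a (b + 1) x
              - matIntegral (gam n) fun x => derivBlocks2 P a (b + 1) x) ∂(gam n)) = I2 at *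
  generalize schattenPow t (matIntegral (gam n) fun x => derivBlocks2 P (a + 1) b x) = I3 at *
  generalize schattenPow t (matIntegral (gam n) fun x => derivBlocks2 P a (b + 1) x) = I4 at *
  have h0 : 0 ≤ (2 * t - 1) ^ t / 2 := by
    have : 0 ≤ 2 * t - 1 := by linarith
    positivity
  calc _ ≤ (Real.pi / 2) ^ (2 * t) * ((2 * t - 1) ^ t / 2 *
        (2 ^ (2 * t) / 2 * (I1 + I3) + 2 ^ (2 * t) / 2 * (I2 + I4))) := by
        refine mul_le_mul_of_nonneg_left (mul_le_mul_of_nonneg_left (add_le_add s1 s2) h0) (by positivity)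
    _ = ((Real.pi / 2) ^ (2 * t) * ((2 * t - 1) ^ t / 2 * (2 ^ (2 * t) / 2))) * (I1 + I3 + I2 + I4) := by ring
    _ ≤ _ := mul_le_mul_of_nonneg_right hc (by positivity)

end Fin6

/-- **Gaussian recursion step** (Claim 5.4). Let `x ∼ N(0, Iₙ)` be a standard Gaussian
vector, `P(x) = ∑_{j ∈ [n]^d} (∏_m x_{j m}) • A j` a degree-`d` homogeneous Gaussian
polynomial random matrix, and `a + b = k < d`. Then for every `2 ≤ t < ∞`,
`E ‖P_{a,b} − E P_{a,b}‖_{2t}^{2t}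
  ≤ (2√2 t)^{2t} (E ‖P_{a+1,b} − E P_{a+1,b}‖_{2t}^{2t} + ‖E P_{a+1,b}‖_{2t}^{2t}
    + E ‖P_{a,b+1} − E P_{a,b+1}‖_{2t}^{2t} + ‖E P_{a,b+1}‖_{2t}^{2t})`. -/
theorem gaussian_recursion_step
    (n d : ℕ) {d₁ d₂ : Type*} [Fintype d₁] [Fintype d₂] [DecidableEq d₁] [DecidableEq d₂]
    (μ : Measure (Fin n → ℝ))
    (hμ : μ = Measure.pi fun _ => gaussianReal 0 1)
    (A : (Fin d → Fin n) → Matrix d₁ d₂ ℝ)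
    (P : (Fin n → ℝ) → Matrix d₁ d₂ ℝ)
    (hP : P = fun v => ∑ j : Fin d → Fin n, (∏ m, v (j m)) • A j)
    (a b k : ℕ) (hab : a + b = k) (hk : k < d)
    (t : ℝ) (ht : 2 ≤ t) :
    ∫ x, schattenPow t
        (derivBlocks2 P a b x - matIntegral μ fun x => derivBlocks2 P a b x) ∂μ
      ≤ (2 * Real.sqrt 2 * t) ^ (2 * t) *
          ((∫ x, schattenPow t (derivBlocks2 P (a + 1) b x
              - matIntegral μ fun x => derivBlocks2 P (a + 1) b x) ∂μ)
            + schattenPow t (matIntegral μ fun x => derivBlocks2 P (a + 1) b x)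
            + (∫ x, schattenPow t (derivBlocks2 P a (b + 1) x
                - matIntegral μ fun x => derivBlocks2 P a (b + 1) x) ∂μ)
            + schattenPow t (matIntegral μ fun x => derivBlocks2 P a (b + 1) x)) := by
  subst hμ
  refine final_step ht P (fun r c => ∑ j : Fin d → Fin n, MvPolynomial.C (A j r c) * ∏ m, MvPolynomial.X (j m)) ?_ a b
  intro x r c
  subst hP
  simp [Matrix.sum_apply, mul_comm]
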